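/- arXiv:2303.03138 — 7 statements merged into one kernel-verified Lean document; each statement's English description precedes it below -/
import Mathlib

section
/- Let f(x) = x^n + a·x^2 + b·x + c ∈ ℤ[x] be an irreducible polynomial of degree n ≥ 3 with b^2 = 4·a·c, let θ be a root of f, K = ℚ(θ), and ℤ_K the ring of integers of K. If p is a prime dividing the discriminant D_f of f such that p divides a and p divides c, then p does not divide the index [ℤ_K : ℤ[θ]] if and only if p^2 does not divide c. -/
open Polynomial NumberField

/-- The discriminant of a monic integer polynomial `f`, defined as the discriminant of the
power basis of `ℤ[X]/(f)` (junk value `0` if `f` is not monic). -/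
noncomputable def polyDisc (f : Polynomial ℤ) : ℤ :=
  if hf : f.Monic then Algebra.discr ℤ (AdjoinRoot.powerBasis' hf).basis else 0

/-- The index `[ℤ_K : ℤ[θ]]` of the order generated by `θ` in the ring of integers. -/
noncomputable def polyIndex {K : Type*} [Field K] [NumberField K] (θ : 𝓞 K) : ℕ :=
  ((Algebra.adjoin ℤ {θ}).toSubring.toAddSubgroup).index

theorem AddSubgroup.prime_dvd_index_of_nsmul_mem {G : Type*} [AddCommGroup G] (H : AddSubgroup G)
    {p : ℕ} (hp : p.Prime) {x : G} (hx : x ∉ H) (hpx : p • x ∈ H) : p ∣ H.index := by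
  have : Fact p.Prime := ⟨hp⟩
  have hord : addOrderOf (x : G ⧸ H) = p := by
    refine addOrderOf_eq_prime ?_ ?_
    · exact (QuotientAddGroup.eq_zero_iff (p • x)).2 hpx
    · exact fun h ↦ hx ((QuotientAddGroup.eq_zero_iff x).1 h)
  rw [← hord]
  exact _root_.addOrderOf_dvd_natCard (x : G ⧸ H)

theorem AddSubgroup.exists_nsmul_mem_of_prime_dvd_index {G : Type*} [AddCommGroup G]
    (H : AddSubgroup G) [H.FiniteIndex] {p : ℕ} (hp : p.Prime) (h : p ∣ H.index) :
    ∃ x, x ∉ H ∧ p • x ∈ H := by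
  have : Fact p.Prime := ⟨hp⟩
  obtain ⟨q, hq⟩ := exists_prime_addOrderOf_dvd_card' (G := G ⧸ H) p h
  obtain ⟨x, rfl⟩ := QuotientAddGroup.mk_surjective q
  refine ⟨x, fun hx ↦ ?_, ?_⟩
  · rw [(QuotientAddGroup.eq_zero_iff x).2 hx, addOrderOf_zero] at hq
    exact hp.one_lt.ne hq
  · rw [← QuotientAddGroup.eq_zero_iff, QuotientAddGroup.mk_nsmul, ← hq]
    exact addOrderOf_nsmul_eq_zero _

section

variable {K : Type*} [Field K]

theorem coe_mem_adjoin_singleton_iff {θ x : 𝓞 K} :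
    (x : K) ∈ Algebra.adjoin ℤ {(θ : K)} ↔ x ∈ Algebra.adjoin ℤ {θ} := by
  simp only [Algebra.adjoin_singleton_eq_range_aeval, AlgHom.mem_range, aeval_algebraMap_apply]
  exact exists_congr fun g ↦ RingOfIntegers.coe_injective.eq_iff

variable [NumberField K]

theorem finiteIndex_adjoin_singleton {θ : 𝓞 K} (hgen : Algebra.adjoin ℚ {(θ : K)} = ⊤) :
    (Algebra.adjoin ℤ {θ}).toSubring.toAddSubgroup.FiniteIndex := by
  set H := (Algebra.adjoin ℤ {θ}).toSubring.toAddSubgroup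
  let B : PowerBasis ℚ K := PowerBasis.ofAdjoinEqTop (Algebra.IsIntegral.isIntegral _) hgen
  have hB : B.gen = θ := PowerBasis.ofAdjoinEqTop_gen _ _
  have hBint : IsIntegral ℤ B.gen := hB ▸ RingOfIntegers.isIntegral_coe θ
  obtain ⟨d, hd⟩ := IsIntegrallyClosed.isIntegral_iff.1
    (Algebra.discr_isIntegral ℚ (b := B.basis) (R := ℤ) fun i ↦ by
      rw [B.basis_eq_pow]; exact hBint.pow _)
  have hd0 : d ≠ 0 := by
    rintro rfl
    exact Algebra.discr_not_zero_of_basis ℚ B.basis (by simpa using hd.symm)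
  have hmem (x : 𝓞 K) : d • x ∈ H := by
    have h := Algebra.discr_mul_isIntegral_mem_adjoin ℚ hBint (RingOfIntegers.isIntegral_coe x)
    rw [← hd, hB, algebraMap_smul] at h
    exact coe_mem_adjoin_singleton_iff.1 (by simpa using h)
  have : Module.Finite ℤ (𝓞 K ⧸ H) :=
    Module.Finite.of_surjective (QuotientAddGroup.mk' H).toIntLinearMap
      (QuotientAddGroup.mk'_surjective H)
  have : Finite (𝓞 K ⧸ H) := Module.finite_of_fg_torsion _ fun q ↦ by
    induction q using QuotientAddGroup.induction_on with
    | H x =>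
      refine ⟨⟨d, mem_nonZeroDivisors_of_ne_zero hd0⟩, ?_⟩
      exact (QuotientAddGroup.eq_zero_iff (d • x)).2 (hmem x)
  exact AddSubgroup.finiteIndex_of_finite_quotient

theorem not_dvd_polyIndex_of_isEisensteinAt {θ : 𝓞 K} (hgen : Algebra.adjoin ℚ {(θ : K)} = ⊤)
    {p : ℕ} (hp : p.Prime) (h : (minpoly ℤ (θ : K)).IsEisensteinAt (Ideal.span {(p : ℤ)})) :
    ¬ p ∣ polyIndex θ := by
  intro hdvd
  have := finiteIndex_adjoin_singleton hgen
  obtain ⟨x, hx, hpx⟩ := AddSubgroup.exists_nsmul_mem_of_prime_dvd_index _ hp hdvd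
  let B : PowerBasis ℚ K := PowerBasis.ofAdjoinEqTop (Algebra.IsIntegral.isIntegral _) hgen
  have hB : B.gen = θ := PowerBasis.ofAdjoinEqTop_gen _ _
  refine hx (coe_mem_adjoin_singleton_iff.1 ?_)
  rw [← hB] at h ⊢
  refine mem_adjoin_of_smul_prime_smul_of_minpoly_isEisensteinAt (K := ℚ)
    (Nat.prime_iff_prime_int.1 hp) (hB ▸ RingOfIntegers.isIntegral_coe θ)
    (RingOfIntegers.isIntegral_coe x) ?_ h
  rw [hB]
  simpa using coe_mem_adjoin_singleton_iff.2 hpx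

end

theorem minpoly_eq_of_irreducible_of_monic_int {R : Type*} [CommRing R] [IsDomain R] [CharZero R]
    {f : ℤ[X]} (hirr : Irreducible f) (hf : f.Monic) {x : R} (hx : aeval x f = 0) :
    minpoly ℤ x = f := by
  have hint : IsIntegral ℤ x := ⟨f, hf, hx⟩
  refine eq_of_monic_of_associated (minpoly.monic hint) hf ?_
  exact (minpoly.irreducible hint).associated_of_dvd hirr (minpoly.isIntegrallyClosed_dvd hint hx)

/-- If `m * x = g(θ)` with `g` monic of degree smaller than the degree of `θ` and `m` is not a
unit, then `x` is not an integral polynomial in `θ`. -/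
theorem notMem_adjoin_of_smul_eq_aeval_monic {R : Type*} [CommRing R] [IsDomain R] [CharZero R]
    {θ x : R} (hθ : IsIntegral ℤ θ) {g : ℤ[X]} (hg : g.Monic)
    (hdeg : g.degree < (minpoly ℤ θ).degree) {m : ℤ} (hm : ¬ IsUnit m)
    (hx : m • x = aeval θ g) : x ∉ Algebra.adjoin ℤ {θ} := by
  rw [Algebra.adjoin_singleton_eq_range_aeval]
  rintro ⟨q, rfl⟩
  have hmon := minpoly.monic hθ
  change m • aeval θ q = _ at hx
  rw [← aeval_modByMonic_eq_self_of_root (minpoly.aeval ℤ θ)] at hx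
  set r := q %ₘ minpoly ℤ θ
  have hrdeg : r.degree < (minpoly ℤ θ).degree := degree_modByMonic_lt _ hmon
  have hzero : m • r - g = 0 := by
    refine eq_zero_of_dvd_of_degree_lt (p := minpoly ℤ θ)
      (minpoly.isIntegrallyClosed_dvd hθ ?_) ?_
    · simp [← hx]
    · exact (degree_sub_le _ _).trans_lt (max_lt ((degree_smul_le _ _).trans_lt hrdeg) hdeg)
  have hcoeff := congrArg (fun P ↦ P.coeff g.natDegree) (sub_eq_zero.1 hzero)
  simp only [coeff_smul, smul_eq_mul, hg.coeff_natDegree] at hcoeff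
  exact hm (IsUnit.of_mul_eq_one _ hcoeff)

/-- If `θ` is a nonzero root of `X ^ n + a X ^ 2 + p b X + p ^ 2 c`, then `α = -p c / θ` is
integral. -/
theorem isIntegral_of_mul_root_eq {L : Type*} [Field L] {n : ℕ} (hn : 3 ≤ n) {a b c p : ℤ}
    {θ α : L} (hθ : θ ≠ 0)
    (hroot : θ ^ n + a * θ ^ 2 + (p * b) * θ + p ^ 2 * c = 0) (hα : α * θ = -(p * c)) :
    IsIntegral ℤ α := by
  obtain ⟨k, rfl⟩ := Nat.exists_eq_add_of_le' hn
  refine ⟨X ^ (k + 3) + (-C b * X ^ (k + 2) + C (a * c) * X ^ (k + 1) +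
    C ((-1) ^ (k + 3) * p ^ (k + 1) * c ^ (k + 2))), ?_, ?_⟩
  · refine monic_X_pow_add (lt_of_le_of_lt (b := ((k + 2 : ℕ) : WithBot ℕ)) ?_ ?_)
    · compute_degree
      refine max_le (max_le le_rfl ?_) ?_
      · exact WithBot.coe_le_coe.2 (by omega : k + 1 ≤ k + 2)
      · exact_mod_cast Nat.zero_le (k + 2)
    · exact_mod_cast Nat.lt_succ_self _
  · have h1 := congrArg (· ^ (k + 3)) hα
    have h2 := congrArg (· ^ (k + 2)) hα
    have h3 := congrArg (· ^ (k + 1)) hα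
    simp only [mul_pow] at h1 h2 h3
    refine (mul_eq_zero.1 ?_).resolve_left (pow_ne_zero (k + 3) hθ)
    simp only [eval₂_add, eval₂_mul, eval₂_neg, eval₂_pow, eval₂_X, eval₂_C, algebraMap_int_eq,
      Int.coe_castRingHom]
    push_cast
    linear_combination h1 - b * θ * h2 + a * c * θ ^ 2 * h3 +
      (-1) ^ (k + 3) * p ^ (k + 1) * c ^ (k + 2) * hroot

theorem stmt_0 (n : ℕ) (hn : 3 ≤ n) (a b c : ℤ) (habc : b ^ 2 = 4 * a * c)
    (f : Polynomial ℤ) (hf : f = X ^ n + C a * X ^ 2 + C b * X + C c)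
    (hirr : Irreducible f)
    (K : Type*) [Field K] [NumberField K] (θ : 𝓞 K)
    (hroot : Polynomial.aeval (θ : K) f = 0)
    (hgen : Algebra.adjoin ℚ {(θ : K)} = ⊤)
    (p : ℕ) (hp : p.Prime) (hpD : (p : ℤ) ∣ polyDisc f)
    (hpa : (p : ℤ) ∣ a) (hpc : (p : ℤ) ∣ c) :
    ¬ (p ∣ polyIndex θ) ↔ ¬ ((p : ℤ) ^ 2 ∣ c) := by
  have hpZ : Prime (p : ℤ) := Nat.prime_iff_prime_int.1 hp
  have hlow : (C a * X ^ 2 + C b * X + C c).degree < (n : WithBot ℕ) :=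
    lt_of_le_of_lt degree_quadratic_le (by exact_mod_cast hn)
  have hf' : f = X ^ n + (C a * X ^ 2 + C b * X + C c) := by rw [hf]; ring
  have hmonic : f.Monic := hf' ▸ monic_X_pow_add hlow
  have hdeg : f.degree = n := by
    rw [hf', degree_add_eq_left_of_degree_lt (by simpa using hlow), degree_X_pow]
  have hnat : f.natDegree = n := natDegree_eq_of_degree_eq_some hdeg
  have hmin : minpoly ℤ (θ : K) = f := minpoly_eq_of_irreducible_of_monic_int hirr hmonic hroot
  have hint : IsIntegral ℤ (θ : K) := RingOfIntegers.isIntegral_coe θ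
  have hpb : (p : ℤ) ∣ b := by
    refine hpZ.dvd_of_dvd_pow (n := 2) ?_
    rw [habc]
    exact hpc.mul_left _
  have hcoeff0 : f.coeff 0 = c := by
    have : 0 ≠ n := by omega
    simp [hf, coeff_X_pow, this]
  constructor
  · rintro hndvd ⟨c', rfl⟩
    obtain ⟨b', rfl⟩ := hpb
    refine hndvd ?_
    have hθ : (θ : K) ≠ 0 := by
      intro h0
      have : f.natDegree = 1 := by
        rw [← hmin, h0, minpoly_eq_of_irreducible_of_monic_int irreducible_X monic_X (aeval_X _),
          natDegree_X]
      omega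
    have hroot' : (θ : K) ^ n + a * (θ : K) ^ 2 + (p * b') * (θ : K) + p ^ 2 * c' = 0 := by
      simpa [hf] using hroot
    have hint' : IsIntegral ℤ (-(p * c') / (θ : K)) :=
      isIntegral_of_mul_root_eq hn (p := p) hθ (by exact_mod_cast hroot')
        ((div_mul_cancel₀ _ hθ).trans (by push_cast; rfl))
    obtain ⟨α, hα⟩ : ∃ α : 𝓞 K, (α : K) = -(p * c') / θ := ⟨⟨_, hint'⟩, rfl⟩
    obtain ⟨m, rfl⟩ := Nat.exists_eq_add_of_le' hn
    have hg2 : (C a * X + C (p * b') : ℤ[X]).degree < ((m + 2 : ℕ) : WithBot ℕ) :=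
      degree_linear_le.trans_lt (by exact_mod_cast (by omega : 1 < m + 2))
    have hsmul : (p : ℤ) • (α : K) =
        aeval (θ : K) (X ^ (m + 2) + (C a * X + C (p * b'))) := by
      simp only [hα, zsmul_eq_mul, map_add, map_mul, map_pow, aeval_X, aeval_C, algebraMap_int_eq,
        Int.coe_castRingHom]
      push_cast
      field_simp
      linear_combination -hroot'
    have hgdeg : (X ^ (m + 2) + (C a * X + C (p * b')) : ℤ[X]).degree <
        (minpoly ℤ (θ : K)).degree := by
      rw [hmin, hdeg, degree_add_eq_left_of_degree_lt (by simpa using hg2), degree_X_pow]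
      exact_mod_cast Nat.lt_succ_self _
    have hnot := notMem_adjoin_of_smul_eq_aeval_monic hint (monic_X_pow_add hg2) hgdeg
      hpZ.not_isUnit hsmul
    refine AddSubgroup.prime_dvd_index_of_nsmul_mem _ hp (x := α)
      (fun h ↦ hnot (coe_mem_adjoin_singleton_iff.2 h)) (coe_mem_adjoin_singleton_iff.1 ?_)
    have hmem := aeval_mem_adjoin_singleton ℤ (θ : K) (p := X ^ (m + 2) + (C a * X + C (p * b')))
    rw [← hsmul] at hmem
    simpa using hmem
  · intro hc
    refine not_dvd_polyIndex_of_isEisensteinAt hgen hp ?_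
    rw [hmin]
    refine ⟨?_, fun {i} hi ↦ ?_, ?_⟩
    · rw [hmonic.leadingCoeff, Ideal.mem_span_singleton]
      exact fun h ↦ hpZ.not_isUnit (isUnit_of_dvd_one h)
    · rw [hnat] at hi
      have hlow_dvd : C (p : ℤ) ∣ C a * X ^ 2 + C b * X + C c :=
        dvd_add (dvd_add ((map_dvd C hpa).mul_right _) ((map_dvd C hpb).mul_right _)) (map_dvd C hpc)
      rw [Ideal.mem_span_singleton, hf', coeff_add, coeff_X_pow, if_neg hi.ne, zero_add]
      exact C_dvd_iff_dvd_coeff _ _ |>.1 hlow_dvd i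
    · rwa [Ideal.span_singleton_pow, Ideal.mem_span_singleton, hcoeff0]
end

section
/- Let f(x) = x^n + a·x^2 + b·x + c ∈ ℤ[x] be an irreducible polynomial of degree n ≥ 3 with b^2 = 4·a·c, let θ be a root of f, K = ℚ(θ), and ℤ_K the ring of integers of K. Let p be a prime dividing the discriminant D_f of f such that p divides a and p does not divide c, and let r ≥ 1 be the exact power of p dividing n (necessarily p divides n). Set c₁ = (c + (−c)^{p^r})/p and b₁ = b/p (both integers). Then p does not divide the index [ℤ_K : ℤ[θ]] if and only if either (p divides b₁ and p does not divide c₁) or p does not divide b₁·((−c₁)^n + c·b₁^n). -/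
open Polynomial NumberField

section ReductionModP

variable {p : ℕ}

theorem map_castRingHom_zmod_eq_zero_iff {P : ℤ[X]} :
    P.map (Int.castRingHom (ZMod p)) = 0 ↔ C (p : ℤ) ∣ P := by
  rw [C_dvd_iff_dvd_coeff, Polynomial.ext_iff]
  simp [ZMod.intCast_zmod_eq_zero_iff_dvd]

theorem exists_map_castRingHom_zmod_eq (P : (ZMod p)[X]) :
    ∃ Q : ℤ[X], Q.map (Int.castRingHom (ZMod p)) = P :=
  map_surjective _ ZMod.intCast_surjective P

theorem exists_eq_add_C_mul_of_map_eq {P Q : ℤ[X]}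
    (h : P.map (Int.castRingHom (ZMod p)) = Q.map (Int.castRingHom (ZMod p))) :
    ∃ R : ℤ[X], P = Q + C (p : ℤ) * R := by
  obtain ⟨R, hR⟩ := map_castRingHom_zmod_eq_zero_iff.mp
    (show (P - Q).map (Int.castRingHom (ZMod p)) = 0 by rw [Polynomial.map_sub, h, sub_self])
  exact ⟨R, by rw [← hR]; ring⟩

end ReductionModP

theorem mem_adjoin_int_singleton_iff {A : Type*} [CommRing A] {θ x : A} :
    x ∈ Algebra.adjoin ℤ {θ} ↔ ∃ P : ℤ[X], aeval θ P = x := by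
  rw [Algebra.adjoin_singleton_eq_range_aeval]; rfl

/-- If `γ β` lies in `ℤ[θ]` with `β` integral over `ℤ` and `γ = g(θ)`, then some power of `γ β`
lies in the ideal `γ ℤ[θ]`. -/
theorem exists_pow_mul_eq_mul_aeval {A : Type*} [CommRing A] {θ β : A} (hβ : IsIntegral ℤ β)
    {g Z : ℤ[X]} (hZ : aeval θ Z = aeval θ g * β) :
    ∃ (d : ℕ) (Y : ℤ[X]), aeval θ (Z ^ d) = aeval θ (g * Y) := by
  obtain ⟨P, hP, hPβ⟩ := hβ
  refine ⟨P.natDegree, -∑ i ∈ Finset.range P.natDegree,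
    C (P.coeff i) * Z ^ i * g ^ (P.natDegree - 1 - i), ?_⟩
  rw [hP.as_sum] at hPβ
  simp only [eval₂_add, eval₂_finsetSum, eval₂_X_pow, eval₂_mul, eval₂_C] at hPβ
  simp only [map_pow, map_mul, map_neg, map_sum, aeval_C, hZ]
  rw [mul_pow, eq_neg_of_add_eq_zero_left hPβ, mul_neg, mul_neg, Finset.mul_sum, Finset.mul_sum]
  congr 1
  refine Finset.sum_congr rfl fun i hi => ?_
  have hi := Finset.mem_range.mp hi
  have h1 : P.natDegree = 1 + i + (P.natDegree - 1 - i) := by omega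
  conv_lhs => rw [h1]
  ring

section Index

variable {K : Type*} [Field K] [NumberField K] {θ : 𝓞 K}

theorem exists_ne_zero_mul_mem_adjoin (hgen : Algebra.adjoin ℚ {(θ : K)} = ⊤) (α : 𝓞 K) :
    ∃ d : ℤ, d ≠ 0 ∧ (d : 𝓞 K) * α ∈ Algebra.adjoin ℤ {θ} := by
  have hα : (α : K) ∈ Algebra.adjoin ℚ {(θ : K)} := hgen ▸ Algebra.mem_top
  rw [Algebra.adjoin_singleton_eq_range_aeval] at hα
  obtain ⟨P, hP : aeval (θ : K) P = α⟩ := hα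
  obtain ⟨d, hd, h⟩ := IsLocalization.integerNormalization_spec (nonZeroDivisors ℤ) P
  refine ⟨d, nonZeroDivisors.ne_zero hd, mem_adjoin_int_singleton_iff.mpr
    ⟨IsLocalization.integerNormalization (nonZeroDivisors ℤ) P, ?_⟩⟩
  apply RingOfIntegers.coe_injective
  have h3 := congrArg (aeval (θ : K)) h
  rw [aeval_map_algebraMap, map_zsmul, zsmul_eq_mul, hP] at h3
  rw [← aeval_algebraMap_apply, h3, map_mul, map_intCast]

theorem dvd_polyIndex_iff (hgen : Algebra.adjoin ℚ {(θ : K)} = ⊤) {p : ℕ} (hp : p.Prime) :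
    p ∣ polyIndex θ ↔
      ∃ α : 𝓞 K, (p : 𝓞 K) * α ∈ Algebra.adjoin ℤ {θ} ∧ α ∉ Algebra.adjoin ℤ {θ} := by
  set S : AddSubgroup (𝓞 K) := (Algebra.adjoin ℤ {θ}).toSubring.toAddSubgroup with hS
  have hmem : ∀ x, x ∈ S ↔ x ∈ Algebra.adjoin ℤ {θ} := fun x => Iff.rfl
  have : Finite (𝓞 K ⧸ S) := by
    have : AddGroup.FG (𝓞 K) := Module.Finite.iff_addGroup_fg.mp inferInstance
    refine AddCommGroup.finite_of_fg_isAddTorsion _ fun x => ?_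
    obtain ⟨α, rfl⟩ := QuotientAddGroup.mk_surjective x
    obtain ⟨d, hd, h⟩ := exists_ne_zero_mul_mem_adjoin hgen α
    rw [isOfFinAddOrder_iff_zsmul_eq_zero]
    refine ⟨d, hd, ?_⟩
    rw [← QuotientAddGroup.mk_zsmul, QuotientAddGroup.eq_zero_iff, hmem, zsmul_eq_mul]
    exact h
  have : Fact p.Prime := ⟨hp⟩
  have key : ∀ α : 𝓞 K, p • (α : 𝓞 K ⧸ S) = 0 ↔ (p : 𝓞 K) * α ∈ Algebra.adjoin ℤ {θ} := by
    intro α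
    rw [← QuotientAddGroup.mk_nsmul, QuotientAddGroup.eq_zero_iff, hmem, nsmul_eq_mul]
  change p ∣ Nat.card (𝓞 K ⧸ S) ↔ _
  constructor
  · intro h
    obtain ⟨x, hx⟩ := exists_prime_addOrderOf_dvd_card' p h
    obtain ⟨α, rfl⟩ := QuotientAddGroup.mk_surjective x
    refine ⟨α, (key α).mp (hx ▸ addOrderOf_nsmul_eq_zero _), fun hα => hp.ne_one ?_⟩
    rw [← hx, AddMonoid.addOrderOf_eq_one_iff, QuotientAddGroup.eq_zero_iff, hmem]
    exact hα
  · rintro ⟨α, h1, h2⟩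
    rw [← addOrderOf_eq_prime ((key α).mpr h1)
      (fun h => h2 ((hmem α).mp ((QuotientAddGroup.eq_zero_iff α).mp h)))]
    exact addOrderOf_dvd_natCard _

end Index

section DedekindCriterion

variable {p q : ℕ} {f g F : ℤ[X]}

/-- The maximality half of Dedekind's criterion: if `f = g ^ q + p F` with `g` squarefree
modulo `p` and coprime to `F` modulo `p`, then `ℤ[θ]` is `p`-saturated in every domain of
characteristic zero that is integral over `ℤ`. -/
theorem mem_adjoin_of_isCoprime {A : Type*} [CommRing A] [IsDomain A] [CharZero A]
    [Algebra.IsIntegral ℤ A] {θ : A}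
    (hker : ∀ P : ℤ[X], aeval θ P = 0 ↔ f ∣ P) (hfg : f = g ^ q + C (p : ℤ) * F) (hq : q ≠ 0)
    (hp : p.Prime) (hsq : Squarefree (g.map (Int.castRingHom (ZMod p))))
    (hco : IsCoprime (g.map (Int.castRingHom (ZMod p))) (F.map (Int.castRingHom (ZMod p))))
    {α : A} (hpα : (p : A) * α ∈ Algebra.adjoin ℤ {θ}) :
    α ∈ Algebra.adjoin ℤ {θ} := by
  have : Fact p.Prime := ⟨hp⟩
  set O := Algebra.adjoin ℤ {θ} with hO
  have hev : ∀ P : ℤ[X], aeval θ P ∈ O := fun P => mem_adjoin_int_singleton_iff.mpr ⟨P, rfl⟩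
  have hrel : aeval θ g ^ q + p * aeval θ F = 0 := by
    have := (hker f).mpr dvd_rfl
    rw [hfg] at this
    simpa using this
  obtain ⟨u', v', huv⟩ := hco
  obtain ⟨u, rfl⟩ := exists_map_castRingHom_zmod_eq u'
  obtain ⟨v, rfl⟩ := exists_map_castRingHom_zmod_eq v'
  obtain ⟨w, hw⟩ := exists_eq_add_C_mul_of_map_eq (p := p) (P := u * g + v * F) (Q := 1)
    (by simpa using huv)
  have hbez : aeval θ u * aeval θ g + aeval θ v * aeval θ F = 1 + p * aeval θ w := by
    simpa using congrArg (aeval θ) hw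
  have step : ∀ β : A, (p : A) * β ∈ O → aeval θ g * β ∈ O → β ∈ O := by
    intro β hpβ hgβ
    obtain ⟨Z, hZ⟩ := mem_adjoin_int_singleton_iff.mp hgβ
    obtain ⟨d, Y, hY⟩ := exists_pow_mul_eq_mul_aeval (Algebra.IsIntegral.isIntegral β) hZ
    have hdvd : f ∣ Z ^ d - g * Y := (hker _).mp (by rw [map_sub, hY, sub_self])
    have hfmap : f.map (Int.castRingHom (ZMod p)) = g.map (Int.castRingHom (ZMod p)) ^ q := by
      simp [hfg]
    have hgZ : g.map (Int.castRingHom (ZMod p)) ∣ Z.map (Int.castRingHom (ZMod p)) := by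
      refine hsq.isRadical d _ ?_
      have h1 := Polynomial.map_dvd (Int.castRingHom (ZMod p)) hdvd
      rw [hfmap, Polynomial.map_sub, Polynomial.map_pow, Polynomial.map_mul] at h1
      exact (dvd_sub_left (dvd_mul_right _ _)).mp ((dvd_pow_self _ hq).trans h1)
    obtain ⟨A', hA'⟩ := hgZ
    obtain ⟨B, rfl⟩ := exists_map_castRingHom_zmod_eq A'
    obtain ⟨E, hE⟩ := exists_eq_add_C_mul_of_map_eq (p := p) (P := Z) (Q := g * B)
      (by simpa using hA')
    have hZE : aeval θ g * β = aeval θ g * aeval θ B + p * aeval θ E := by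
      rw [← hZ, hE]; simp
    have key : (1 + p * aeval θ w) * β ∈ O := by
      rcases eq_or_ne (aeval θ g) 0 with h0 | h0
      · rw [h0, zero_pow hq, zero_add] at hrel
        rw [← hbez, h0, mul_zero, zero_add]
        rcases mul_eq_zero.mp hrel with hp0 | hF
        · exact absurd hp0 (Nat.cast_ne_zero.mpr hp.ne_zero)
        · rw [hF, mul_zero, zero_mul]; exact zero_mem _
      · have : (1 + p * aeval θ w) * β = (1 + p * aeval θ w) * aeval θ B
            + (p * aeval θ u - aeval θ v * aeval θ g ^ (q - 1)) * aeval θ E := by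
          apply mul_left_cancel₀ h0
          have hq' : aeval θ g ^ q = aeval θ g * aeval θ g ^ (q - 1) := by
            rw [← pow_succ', Nat.sub_add_cancel (Nat.pos_of_ne_zero hq)]
          rw [hq'] at hrel
          linear_combination (1 + p * aeval θ w) * hZE - p * aeval θ E * hbez
            + aeval θ v * aeval θ E * hrel
        rw [this]
        simpa using hev ((1 + C (p : ℤ) * w) * B + (C (p : ℤ) * u - v * g ^ (q - 1)) * E)
    have : β = (1 + p * aeval θ w) * β - aeval θ w * (p * β) := by ring
    rw [this]
    exact sub_mem key (mul_mem (hev w) hpβ)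
  have descent : ∀ (k : ℕ) (β : A), (p : A) * β ∈ O → aeval θ g ^ k * β ∈ O → β ∈ O := by
    intro k
    induction k with
    | zero => intro β _ h; simpa using h
    | succ k ih =>
      intro β hpβ h
      refine step β hpβ (ih _ ?_ ?_)
      · rw [mul_left_comm]; exact mul_mem (hev g) hpβ
      · rwa [← mul_assoc, ← pow_succ]
  refine descent q α hpα ?_
  have : aeval θ g ^ q * α = -(aeval θ F * (p * α)) := by linear_combination α * hrel
  rw [this]
  exact neg_mem (mul_mem (hev F) hpα)

/-- The other half of Dedekind's criterion: if `f = g ^ q + p F` with `2 ≤ q` and `g`, `F` are not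
coprime modulo `p`, then `ℤ[θ]` is not `p`-saturated in its integral closure. -/
theorem exists_isIntegral_notMem_adjoin {K : Type*} [Field K] [CharZero K] {θ : K}
    (hθ : IsIntegral ℤ θ)
    (hker : ∀ P : ℤ[X], aeval θ P = 0 ↔ f ∣ P) (hfg : f = g ^ q + C (p : ℤ) * F) (hq : 2 ≤ q)
    (hp : p.Prime) (hg : g.map (Int.castRingHom (ZMod p)) ≠ 0)
    (hco : ¬ IsCoprime (g.map (Int.castRingHom (ZMod p))) (F.map (Int.castRingHom (ZMod p)))) :
    ∃ α : K, IsIntegral ℤ α ∧ (p : K) * α ∈ Algebra.adjoin ℤ {θ} ∧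
      α ∉ Algebra.adjoin ℤ {θ} := by
  classical
  have : Fact p.Prime := ⟨hp⟩
  have hp0 : (p : K) ≠ 0 := Nat.cast_ne_zero.mpr hp.ne_zero
  rw [← EuclideanDomain.gcd_isUnit_iff] at hco
  obtain ⟨k', hk'⟩ := EuclideanDomain.gcd_dvd_left (g.map (Int.castRingHom (ZMod p)))
    (F.map (Int.castRingHom (ZMod p)))
  obtain ⟨l', hl'⟩ := EuclideanDomain.gcd_dvd_right (g.map (Int.castRingHom (ZMod p)))
    (F.map (Int.castRingHom (ZMod p)))
  obtain ⟨h, hh⟩ := exists_map_castRingHom_zmod_eq (EuclideanDomain.gcd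
    (g.map (Int.castRingHom (ZMod p))) (F.map (Int.castRingHom (ZMod p))))
  rw [← hh] at hco hk' hl'
  obtain ⟨k, rfl⟩ := exists_map_castRingHom_zmod_eq k'
  obtain ⟨l, rfl⟩ := exists_map_castRingHom_zmod_eq l'
  obtain ⟨s, hs⟩ := exists_eq_add_C_mul_of_map_eq (p := p) (P := g) (Q := h * k)
    (by simpa using hk')
  obtain ⟨t, ht⟩ := exists_eq_add_C_mul_of_map_eq (p := p) (P := F) (Q := h * l)
    (by simpa using hl')
  have hrel : aeval θ g ^ q + p * aeval θ F = 0 := by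
    have := (hker f).mpr dvd_rfl
    rw [hfg] at this
    simpa using this
  have hgs : aeval θ g = aeval θ h * aeval θ k + p * aeval θ s := by
    conv_lhs => rw [hs]
    simp
  have hFt : aeval θ F = aeval θ h * aeval θ l + p * aeval θ t := by
    conv_lhs => rw [ht]
    simp
  obtain ⟨j, rfl⟩ := Nat.exists_eq_add_of_le hq
  have hmulp : (p : K) * (aeval θ (k * g ^ (1 + j)) / p) = aeval θ (k * g ^ (1 + j)) := by
    field_simp
  refine ⟨aeval θ (k * g ^ (1 + j)) / p, ?_, ?_, ?_⟩
  · set O := Algebra.adjoin ℤ {θ} with hO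
    have hev : ∀ P : ℤ[X], aeval θ P ∈ O := fun P => mem_adjoin_int_singleton_iff.mpr ⟨P, rfl⟩
    have : Algebra.IsIntegral ℤ O := Algebra.IsIntegral.adjoin (by simpa using hθ)
    refine isIntegral_trans (A := O) _ ?_
    let N : Submodule O K := Submodule.span O {(p : K), aeval θ h}
    have hmem : ∀ P Q : ℤ[X], aeval θ P * p + aeval θ Q * aeval θ h ∈ N := fun P Q =>
      Submodule.mem_span_pair.mpr ⟨⟨_, hev P⟩, ⟨_, hev Q⟩, rfl⟩
    refine isIntegral_of_smul_mem_submodule N ?_ ⟨{(p : K), aeval θ h}, by simp [N]⟩ _ ?_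
    · exact fun hN => hp0 ((Submodule.eq_bot_iff _).mp hN _
        (Submodule.subset_span (Set.mem_insert _ _)))
    · intro y hy
      induction hy using Submodule.span_induction with
      | zero => simp
      | add x y _ _ hx hy => rw [smul_add]; exact add_mem hx hy
      | smul a x _ hx => rw [smul_comm]; exact N.smul_mem a hx
      | mem x hx =>
        rcases hx with rfl | rfl
        · convert hmem (k * g ^ j * s) (k * g ^ j * k) using 1
          rw [smul_eq_mul, mul_comm, hmulp]
          simp only [map_mul, map_pow]
          rw [pow_add, pow_one]
          linear_combination aeval θ k * aeval θ g ^ j * hgs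
        · convert hmem (-t - s * g ^ j * s) (-l - s * g ^ j * k) using 1
          apply mul_left_cancel₀ hp0
          rw [smul_eq_mul, ← mul_assoc, hmulp]
          simp only [map_mul, map_pow, map_sub, map_neg]
          rw [pow_add] at hrel
          rw [pow_add, pow_one]
          linear_combination -(aeval θ g * aeval θ g ^ j + p * aeval θ s * aeval θ g ^ j) * hgs
            + hrel - p * hFt
  · rw [hmulp]; exact mem_adjoin_int_singleton_iff.mpr ⟨_, rfl⟩
  · intro hmem
    obtain ⟨V, hV⟩ := mem_adjoin_int_singleton_iff.mp hmem
    have hdvd : f ∣ k * g ^ (1 + j) - C (p : ℤ) * V := (hker _).mp (by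
      rw [map_sub, ← hmulp, ← hV]; simp)
    have h1 := Polynomial.map_dvd (Int.castRingHom (ZMod p)) hdvd
    have hfmap : f.map (Int.castRingHom (ZMod p))
        = g.map (Int.castRingHom (ZMod p)) * g.map (Int.castRingHom (ZMod p)) ^ (1 + j) := by
      simp [hfg]; ring
    have hV0 : (C (p : ℤ) * V).map (Int.castRingHom (ZMod p)) = 0 :=
      map_castRingHom_zmod_eq_zero_iff.mpr (dvd_mul_right _ _)
    rw [hfmap, Polynomial.map_sub, hV0, sub_zero, Polynomial.map_mul, Polynomial.map_pow,
      mul_dvd_mul_iff_right (pow_ne_zero _ hg), hk'] at h1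
    have hk0 : k.map (Int.castRingHom (ZMod p)) ≠ 0 := fun h0 => hg (by rw [hk', h0, mul_zero])
    exact hco (isUnit_of_dvd_one ((mul_dvd_mul_iff_right hk0).mp (by rwa [one_mul])))

end DedekindCriterion

/-- **Dedekind's index criterion** for a polynomial that is a single power of a squarefree
polynomial modulo `p`. -/
theorem not_dvd_polyIndex_iff_isCoprime {K : Type*} [Field K] [NumberField K] {θ : 𝓞 K}
    {p q : ℕ} {f g F : ℤ[X]} (hirr : Irreducible f) (hmonic : f.Monic)
    (hroot : aeval (θ : K) f = 0) (hgen : Algebra.adjoin ℚ {(θ : K)} = ⊤)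
    (hfg : f = g ^ q + C (p : ℤ) * F) (hq : 2 ≤ q) (hp : p.Prime)
    (hsq : Squarefree (g.map (Int.castRingHom (ZMod p)))) :
    ¬ p ∣ polyIndex θ ↔
      IsCoprime (g.map (Int.castRingHom (ZMod p))) (F.map (Int.castRingHom (ZMod p))) := by
  have : Fact p.Prime := ⟨hp⟩
  have hθ : IsIntegral ℤ (θ : K) := θ.isIntegral_coe
  have hmin : minpoly ℤ (θ : K) = f :=
    eq_of_monic_of_associated (minpoly.monic hθ) hmonic
      ((minpoly.irreducible hθ).associated_of_dvd hirr (minpoly.isIntegrallyClosed_dvd hθ hroot))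
  have hkerK : ∀ P : ℤ[X], aeval (θ : K) P = 0 ↔ f ∣ P := fun P => by
    rw [← hmin]; exact minpoly.isIntegrallyClosed_dvd_iff hθ P
  have hker : ∀ P : ℤ[X], aeval θ P = 0 ↔ f ∣ P := fun P => by
    rw [← hkerK, aeval_algebraMap_apply]
    exact (RingOfIntegers.coe_eq_zero_iff).symm
  rw [dvd_polyIndex_iff hgen hp]
  constructor
  · contrapose!
    intro hco
    obtain ⟨α, hα, hpα, hmem⟩ := exists_isIntegral_notMem_adjoin hθ hkerK hfg hq hp hsq.ne_zero hco
    obtain ⟨α, rfl⟩ := (IsIntegralClosure.isIntegral_iff (A := 𝓞 K)).mp hα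
    refine ⟨α, ?_, fun h => hmem ?_⟩
    · obtain ⟨P, hP⟩ := mem_adjoin_int_singleton_iff.mp hpα
      refine mem_adjoin_int_singleton_iff.mpr ⟨P, RingOfIntegers.coe_injective ?_⟩
      rw [← aeval_algebraMap_apply, hP]
      simp
    · obtain ⟨P, hP⟩ := mem_adjoin_int_singleton_iff.mp h
      refine mem_adjoin_int_singleton_iff.mpr ⟨P, ?_⟩
      rw [aeval_algebraMap_apply, hP]
  · rintro hco ⟨α, hpα, hα⟩
    exact hα (mem_adjoin_of_isCoprime hker hfg (by omega) hp hsq hco hpα)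

/-- If `b ^ 2 = 4 a c` and `p` divides `a` but not `c`, then `p ^ 2` divides `a`. -/
theorem sq_dvd_of_sq_eq_four_mul {p : ℕ} (hp : p.Prime) {a b₁ c : ℤ}
    (h : ((p : ℤ) * b₁) ^ 2 = 4 * a * c) (hpa : (p : ℤ) ∣ a) (hpc : ¬ (p : ℤ) ∣ c) :
    (p : ℤ) ^ 2 ∣ a := by
  have hpZ : Prime (p : ℤ) := Nat.prime_iff_prime_int.mp hp
  rcases hp.eq_two_or_odd' with rfl | hodd
  · have h1 : b₁ ^ 2 = a * c := by push_cast at h; linarith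
    have h2 : (2 : ℤ) ∣ b₁ := by
      refine Int.prime_two.dvd_of_dvd_pow (n := 2) ?_
      rw [h1]; exact dvd_mul_of_dvd_left (by exact_mod_cast hpa) c
    have h3 : ((2 : ℕ) : ℤ) ^ 2 ∣ a * c := h1 ▸ pow_dvd_pow_of_dvd (by exact_mod_cast h2) 2
    exact hpZ.pow_dvd_of_dvd_mul_right 2 hpc h3
  · have h4 : ¬ (p : ℤ) ∣ 4 := by
      intro h4
      have : p ∣ 2 ^ 2 := by exact_mod_cast h4
      have := (Nat.prime_dvd_prime_iff_eq hp Nat.prime_two).mp (hp.dvd_of_dvd_pow this)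
      subst this
      exact absurd hodd (by decide)
    have h1 : (p : ℤ) ^ 2 ∣ 4 * a * c := ⟨b₁ ^ 2, by rw [← h]; ring⟩
    exact hpZ.pow_dvd_of_dvd_mul_left 2 h4 (hpZ.pow_dvd_of_dvd_mul_right 2 hpc h1)

/-- Coprimality of `X ^ m + c` with a polynomial of degree at most one. -/
theorem isCoprime_X_pow_add_C_linear_iff {k : Type*} [Field k] {m : ℕ} (hm : m ≠ 0) (b c d : k) :
    IsCoprime (X ^ m + C c) (C b * X + C d) ↔
      (b = 0 ∧ d ≠ 0) ∨ (b ≠ 0 ∧ (-d) ^ m + c * b ^ m ≠ 0) := by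
  rcases eq_or_ne b 0 with rfl | hb
  · simp only [map_zero, zero_mul, zero_add, true_and, ne_eq, not_true_eq_false, false_and,
      or_false]
    constructor
    · rintro h rfl
      rw [map_zero, isCoprime_zero_right] at h
      exact hm (by rw [← natDegree_X_pow_add_C (n := m) (r := c), natDegree_eq_zero_of_isUnit h])
    · intro hd
      exact isCoprime_one_right.of_isCoprime_of_dvd_right
        (isUnit_C.mpr (isUnit_iff_ne_zero.mpr hd)).dvd
  · have hlin : C b * X + C d = C b * (X - C (-d / b)) := by
      rw [mul_sub, ← C_mul, mul_div_cancel₀ _ hb]; simp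
    simp only [hb, false_and, false_or, ne_eq, not_false_eq_true, true_and]
    rw [hlin, isCoprime_mul_unit_left_right (isUnit_C.mpr hb.isUnit), isCoprime_comm,
      (irreducible_X_sub_C _).coprime_iff_not_dvd, dvd_iff_isRoot, not_iff_not]
    simp only [IsRoot.def, eval_add, eval_pow, eval_X, eval_C]
    rw [div_pow, div_add' _ _ _ (pow_ne_zero _ hb), div_eq_zero_iff]
    simp [hb]

theorem stmt_1 (n : ℕ) (hn : 3 ≤ n) (a b c : ℤ) (habc : b ^ 2 = 4 * a * c)
    (f : Polynomial ℤ) (hf : f = X ^ n + C a * X ^ 2 + C b * X + C c)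
    (hirr : Irreducible f)
    (K : Type*) [Field K] [NumberField K] (θ : 𝓞 K)
    (hroot : Polynomial.aeval (θ : K) f = 0)
    (hgen : Algebra.adjoin ℚ {(θ : K)} = ⊤)
    (p : ℕ) (hp : p.Prime) (hpD : (p : ℤ) ∣ polyDisc f)
    (hpa : (p : ℤ) ∣ a) (hpc : ¬ (p : ℤ) ∣ c)
    (r : ℕ) (hr : 1 ≤ r) (hrdvd : p ^ r ∣ n) (hrexact : ¬ p ^ (r + 1) ∣ n)
    (b₁ c₁ : ℤ) (hb₁ : (p : ℤ) * b₁ = b) (hc₁ : (p : ℤ) * c₁ = c + (-c) ^ p ^ r) :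
    ¬ (p ∣ polyIndex θ) ↔
      (((p : ℤ) ∣ b₁ ∧ ¬ (p : ℤ) ∣ c₁) ∨
        ¬ (p : ℤ) ∣ b₁ * ((-c₁) ^ n + c * b₁ ^ n)) := by
  have : Fact p.Prime := ⟨hp⟩
  subst hb₁
  obtain ⟨a₂, ha₂⟩ := sq_dvd_of_sq_eq_four_mul hp habc hpa hpc
  obtain ⟨m, hm⟩ := hrdvd
  have hpm : ¬ p ∣ m := fun ⟨t, ht⟩ => hrexact ⟨t, by rw [hm, ht, pow_succ, mul_assoc]⟩
  have hm0 : m ≠ 0 := fun h => hpm (h ▸ dvd_zero p)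
  have hc0 : (c : ZMod p) ≠ 0 := by rwa [Ne, ZMod.intCast_zmod_eq_zero_iff_dvd]
  have hmonic : f.Monic := by
    rw [hf, add_assoc, add_assoc]
    refine monic_X_pow_add (lt_of_le_of_lt ?_ (Nat.cast_lt.mpr hn : ((2 : ℕ) : WithBot ℕ) < n))
    rw [← add_assoc]
    exact degree_quadratic_le
  obtain ⟨R, hR⟩ := exists_add_pow_prime_pow_eq hp (X ^ m + C c : ℤ[X]) (-C c) r
  have hfg : f = (X ^ m + C c) ^ p ^ r + C (p : ℤ) *
      ((C b₁ * X + C c₁ + C (p : ℤ) * (C a₂ * X ^ 2)) + (X ^ m + C c) * (-C c * R)) := by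
    have hc₁' : C (p : ℤ) * C c₁ = C c + (-C c) ^ p ^ r := by
      rw [← C_mul, hc₁]; simp
    have hpC : ((p : ℕ) : ℤ[X]) = C (p : ℤ) := by simp
    rw [add_neg_cancel_right, ← pow_mul, mul_comm m, ← hm, hpC] at hR
    rw [hf, hR, ha₂, C_mul, C_mul, C_pow]
    linear_combination -hc₁'
  have hq : 2 ≤ p ^ r := hp.two_le.trans (Nat.le_self_pow (by omega) p)
  have hgmap : (X ^ m + C c : ℤ[X]).map (Int.castRingHom (ZMod p)) = X ^ m + C (c : ZMod p) := by
    simp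
  have hsq : Squarefree ((X ^ m + C c : ℤ[X]).map (Int.castRingHom (ZMod p))) := by
    rw [hgmap, ← sub_neg_eq_add, ← C_neg]
    exact (separable_X_pow_sub_C' p m _ hpm (neg_ne_zero.mpr hc0)).squarefree
  have hFmap : (C b₁ * X + C c₁ + C (p : ℤ) * (C a₂ * X ^ 2) : ℤ[X]).map
      (Int.castRingHom (ZMod p)) = C (b₁ : ZMod p) * X + C (c₁ : ZMod p) := by
    simp
  rw [not_dvd_polyIndex_iff_isCoprime hirr hmonic hroot hgen hfg hq hp hsq, hgmap,
    Polynomial.map_add, Polynomial.map_mul, hgmap, IsCoprime.add_mul_left_right_iff, hFmap,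
    isCoprime_X_pow_add_C_linear_iff hm0]
  have hpow : (((-c₁) ^ n + c * b₁ ^ n : ℤ) : ZMod p)
      = ((-(c₁ : ZMod p)) ^ m + c * (b₁ : ZMod p) ^ m) ^ p ^ r := by
    rw [add_pow_char_pow, mul_pow, ← pow_mul, ← pow_mul, mul_comm m, ← hm, ZMod.pow_card_pow]
    push_cast
    rfl
  rw [← ZMod.intCast_zmod_eq_zero_iff_dvd, ← ZMod.intCast_zmod_eq_zero_iff_dvd,
    ← ZMod.intCast_zmod_eq_zero_iff_dvd, Int.cast_mul, hpow, mul_eq_zero,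
    pow_eq_zero_iff (by omega)]
  tauto
end

section
/- Let f(x) = x^n + a·x^2 + b·x + c ∈ ℤ[x] be an irreducible polynomial of degree n ≥ 3 with b^2 = 4·a·c, let θ be a root of f, K = ℚ(θ), and ℤ_K the ring of integers of K. Suppose the prime 2 divides the discriminant D_f of f and 2 does not divide a·c. Then 2 does not divide the index [ℤ_K : ℤ[θ]] if and only if a ≡ 1 (mod 4) or c ≡ 1 (mod 4). -/
open Polynomial NumberField

theorem exists_int_mul_eq_aeval {K : Type*} [Field K] [CharZero K] {x : K}
    (hx : Algebra.adjoin ℚ {x} = ⊤) (y : K) :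
    ∃ d : ℤ, d ≠ 0 ∧ ∃ P : ℤ[X], (d : K) * y = aeval x P := by
  have hy : y ∈ Algebra.adjoin ℚ {x} := hx ▸ Algebra.mem_top
  rw [Algebra.adjoin_singleton_eq_range_aeval] at hy
  obtain ⟨q, rfl⟩ := hy
  obtain ⟨d, hd0, hd⟩ := IsLocalization.integerNormalization_spec (nonZeroDivisors ℤ) q
  refine ⟨d, nonZeroDivisors.ne_zero hd0,
    IsLocalization.integerNormalization (nonZeroDivisors ℤ) q, ?_⟩
  have := congrArg (aeval x) hd
  rw [aeval_map_algebraMap] at this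
  rw [this]
  simp

theorem not_dvd_norm_one_add_mul {A : Type*} [CommRing A] [Module.Free ℤ A] [Module.Finite ℤ A]
    {p : ℕ} (hp : p.Prime) (y : A) : ¬ (p : ℤ) ∣ Algebra.norm ℤ (1 + p * y) := by
  have := Fact.mk hp
  let b := Module.Free.chooseBasis ℤ A
  rw [← ZMod.intCast_zmod_eq_zero_iff_dvd, Algebra.norm_eq_matrix_det b, ← eq_intCast
    (Int.castRingHom (ZMod p)), RingHom.map_det]
  have hp0 (M : Matrix (Module.Free.ChooseBasisIndex ℤ A) (Module.Free.ChooseBasisIndex ℤ A) ℤ) :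
      (Int.castRingHom (ZMod p)).mapMatrix ((p : Matrix _ _ ℤ) * M) = 0 := by
    rw [← nsmul_eq_mul, map_nsmul]
    ext i j
    rw [Matrix.smul_apply, nsmul_eq_mul, CharP.cast_eq_zero, zero_mul, Matrix.zero_apply]
  rw [map_add, map_mul, map_one, map_natCast, map_add, map_one, hp0, add_zero, Matrix.det_one]
  exact one_ne_zero

theorem exists_eq_mul_add_of_map_dvd {p : ℕ} {g P : ℤ[X]}
    (h : g.map (Int.castRingHom (ZMod p)) ∣ P.map (Int.castRingHom (ZMod p))) :
    ∃ Q S : ℤ[X], P = g * Q + p * S := by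
  obtain ⟨q, hq⟩ := h
  obtain ⟨Q, rfl⟩ := Polynomial.map_surjective (Int.castRingHom (ZMod p)) (ZMod.ringHom_surjective _) q
  have h0 : C (p : ℤ) ∣ P - g * Q := by
    rw [C_dvd_iff_dvd_coeff]
    intro i
    rw [← ZMod.intCast_zmod_eq_zero_iff_dvd, ← eq_intCast (Int.castRingHom (ZMod p)), ← coeff_map]
    simp [hq]
  obtain ⟨S, hS⟩ := h0
  exact ⟨Q, S, by rw [← sub_eq_iff_eq_add', hS]; simp⟩

section Root

variable {K : Type*} [Field K] {f : ℤ[X]} {θ : 𝓞 K}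

theorem minpoly_eq_of_irreducible_of_monic [CharZero K] (hm : f.Monic) (hirr : Irreducible f)
    (hroot : aeval θ f = 0) : minpoly ℤ θ = f := by
  have hint : IsIntegral ℤ θ := ⟨f, hm, hroot⟩
  obtain ⟨u, hu⟩ := minpoly.isIntegrallyClosed_dvd hint hroot
  refine eq_of_monic_of_associated (minpoly.monic hint) hm ?_
  exact (minpoly.irreducible hint).associated_of_dvd hirr ⟨u, hu⟩

theorem dvd_of_aeval_eq_zero [CharZero K] (hm : f.Monic) (hirr : Irreducible f)
    (hroot : aeval θ f = 0) {P : ℤ[X]} (hP : aeval θ P = 0) : f ∣ P := by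
  rw [← minpoly_eq_of_irreducible_of_monic hm hirr hroot]
  exact minpoly.isIntegrallyClosed_dvd ⟨f, hm, hroot⟩ hP

theorem exists_map_dvd_pow [CharZero K] (hm : f.Monic) (hirr : Irreducible f)
    (hroot : aeval θ f = 0) {p : ℕ} (hp : p.Prime) {β : 𝓞 K} {P : ℤ[X]} (hβ : p * β = aeval θ P) :
    ∃ k : ℕ, f.map (Int.castRingHom (ZMod p)) ∣ P.map (Int.castRingHom (ZMod p)) ^ k := by
  obtain ⟨q, hq, hqβ⟩ := RingOfIntegers.isIntegral β
  have h1 : aeval θ ((q.scaleRoots (p : ℤ)).comp P) = 0 := by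
    rw [aeval_comp, ← hβ]
    have := scaleRoots_aeval_eq_zero (r := (p : ℤ)) (show aeval β q = 0 from hqβ)
    simpa using this
  have := Fact.mk hp
  refine ⟨(q.map (Int.castRingHom (ZMod p))).natDegree, ?_⟩
  have h2 := Polynomial.map_dvd (Int.castRingHom (ZMod p)) (dvd_of_aeval_eq_zero hm hirr hroot h1)
  rw [Polynomial.map_comp, map_scaleRoots _ _ _ (by simp [hq.leadingCoeff])] at h2
  have h3 : (Int.castRingHom (ZMod p)) (p : ℤ) = 0 := by simp
  rwa [h3, scaleRoots_zero, (hq.map _).leadingCoeff, one_smul, X_pow_comp] at h2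

/-- The half of Dedekind's index criterion saying that `ℤ[θ]` is `p`-maximal, for a polynomial
which is a square modulo `p`. -/
theorem mem_adjoin_of_mul_mem_adjoin [CharZero K] (hm : f.Monic) (hirr : Irreducible f)
    (hroot : aeval θ f = 0) {p : ℕ} (hp : p.Prime) {g F : ℤ[X]} (hfg : f = g ^ 2 + p * F)
    (hsq : Squarefree (g.map (Int.castRingHom (ZMod p))))
    (hcop : IsCoprime (g.map (Int.castRingHom (ZMod p))) (F.map (Int.castRingHom (ZMod p))))
    {β : 𝓞 K} (hβ : p * β ∈ Algebra.adjoin ℤ {θ}) : β ∈ Algebra.adjoin ℤ {θ} := by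
  have := Fact.mk hp
  have hp0 : (p : 𝓞 K) ≠ 0 := by exact_mod_cast hp.ne_zero
  have key : ∀ {γ : 𝓞 K} {P : ℤ[X]}, p * γ = aeval θ P →
      g.map (Int.castRingHom (ZMod p)) ∣ P.map (Int.castRingHom (ZMod p)) := by
    intro γ P h
    obtain ⟨k, hk⟩ := exists_map_dvd_pow hm hirr hroot hp h
    refine hsq.isRadical k _ (dvd_trans ?_ hk)
    rw [hfg]
    simp [pow_two]
  rw [Algebra.adjoin_singleton_eq_range_aeval] at hβ ⊢
  obtain ⟨P, hP⟩ := hβ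
  obtain ⟨Q, S, rfl⟩ := exists_eq_mul_add_of_map_dvd (key hP.symm)
  have hu : (aeval θ g) ^ 2 = - (p * aeval θ F) := by
    rw [hfg] at hroot
    simp only [map_add, map_mul, map_pow, map_natCast] at hroot
    linear_combination hroot
  simp only [map_add, map_mul, map_natCast, AlgHom.toRingHom_eq_coe, RingHom.coe_coe] at hP
  have h1 : (p : 𝓞 K) * (β - aeval θ S) ^ 2 = aeval θ (-(F * Q ^ 2)) := by
    apply mul_left_cancel₀ hp0
    simp only [map_neg, map_mul, map_pow]
    linear_combination (-(p * (β - aeval θ S)) - aeval θ g * aeval θ Q) * hP + (aeval θ Q) ^ 2 * hu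
  have h2 := key h1
  rw [Polynomial.map_neg, dvd_neg, Polynomial.map_mul, Polynomial.map_pow] at h2
  have h3 := (hsq.dvd_pow_iff_dvd two_ne_zero).1 (hcop.dvd_of_dvd_mul_left h2)
  obtain ⟨T, U, rfl⟩ := exists_eq_mul_add_of_map_dvd h3
  refine ⟨-(F * T) + U * g + S, ?_⟩
  apply mul_left_cancel₀ hp0
  simp only [map_add, map_mul, map_natCast, map_neg, AlgHom.toRingHom_eq_coe,
    RingHom.coe_coe] at hP ⊢
  linear_combination hP - aeval θ T * hu

theorem dvd_index_of_mul_mem {A : Type*} [AddCommGroup A] {H : AddSubgroup A} {p : ℕ}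
    (hp : p.Prime) {y : A} (hy : y ∉ H) (hpy : p • y ∈ H) : p ∣ H.index := by
  have := Fact.mk hp
  have h : addOrderOf (QuotientAddGroup.mk' H y) = p := by
    refine addOrderOf_eq_prime ?_ ?_
    · rwa [← map_nsmul, QuotientAddGroup.mk'_apply, QuotientAddGroup.eq_zero_iff]
    · rwa [QuotientAddGroup.mk'_apply, Ne, QuotientAddGroup.eq_zero_iff]
  rw [← h]
  exact addOrderOf_dvd_natCard _

theorem dvd_polyIndex [NumberField K] (hm : f.Monic) (hirr : Irreducible f)
    (hroot : aeval θ f = 0) {p : ℕ} (hp : p.Prime) {g q r : ℤ[X]} (hg : g.Monic)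
    (hdeg : g.degree < f.degree) (hfg : f = g ^ 2 + p * g * q + p ^ 2 * r) :
    p ∣ polyIndex θ := by
  have := Fact.mk hp
  have hp0 : (p : K) ≠ 0 := by exact_mod_cast hp.ne_zero
  have hrootK : aeval (θ : K) f = 0 := by rw [aeval_algebraMap_apply, hroot, map_zero]
  have hint : IsIntegral (𝓞 K) (aeval (θ : K) g / p) := by
    refine ⟨X ^ 2 + (C (aeval θ q) * X + C (aeval θ r)),
      monic_X_pow_add (degree_linear_le.trans_lt (by norm_num)), ?_⟩
    rw [hfg] at hrootK
    simp only [map_add, map_mul, map_pow, map_natCast] at hrootK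
    simp only [eval₂_add, eval₂_mul, eval₂_pow, eval₂_X, eval₂_C, ← aeval_algebraMap_apply]
    field_simp
    linear_combination hrootK
  obtain ⟨y, hy⟩ := IsIntegrallyClosed.isIntegral_iff.1 hint
  have hpy : (p : 𝓞 K) * y = aeval θ g := by
    apply RingOfIntegers.coe_injective
    rw [map_mul, hy, map_natCast, ← aeval_algebraMap_apply, mul_div_cancel₀ _ hp0]
  refine dvd_index_of_mul_mem (y := y) hp ?_ ?_
  · intro hmem
    replace hmem : y ∈ Algebra.adjoin ℤ {θ} := hmem
    rw [Algebra.adjoin_singleton_eq_range_aeval] at hmem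
    obtain ⟨P, hP⟩ := hmem
    replace hP : aeval θ P = y := hP
    have hdvd : f ∣ g - p * P := dvd_of_aeval_eq_zero hm hirr hroot (by simp [hP, hpy])
    have hdvd' := Polynomial.map_dvd (Int.castRingHom (ZMod p)) hdvd
    simp only [Polynomial.map_sub, Polynomial.map_mul, Polynomial.map_natCast,
      CharP.cast_eq_zero, zero_mul, sub_zero] at hdvd'
    refine not_dvd_of_degree_lt (hg.map _).ne_zero ?_ hdvd'
    rwa [hg.degree_map, hm.degree_map]
  · change p • y ∈ Algebra.adjoin ℤ {θ}
    rw [nsmul_eq_mul, hpy]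
    exact aeval_mem_adjoin_singleton ℤ θ

theorem not_dvd_polyIndex [NumberField K] (hgen : Algebra.adjoin ℚ {(θ : K)} = ⊤) {p : ℕ}
    (hp : p.Prime)
    (h : ∀ β : 𝓞 K, p * β ∈ Algebra.adjoin ℤ {θ} → β ∈ Algebra.adjoin ℤ {θ}) :
    ¬ p ∣ polyIndex θ := by
  have := Fact.mk hp
  let H := (Algebra.adjoin ℤ {θ}).toSubring.toAddSubgroup
  have hmem {y : 𝓞 K} : y ∈ H ↔ y ∈ Algebra.adjoin ℤ {θ} := Iff.rfl
  have hfg : AddGroup.FG (𝓞 K) := Module.Finite.iff_addGroup_fg.1 inferInstance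
  have htors : IsAddTorsion (𝓞 K ⧸ H) := by
    intro y
    induction y using QuotientAddGroup.induction_on with | H y =>
    obtain ⟨d, hd, P, hP⟩ := exists_int_mul_eq_aeval hgen (y : K)
    rw [isOfFinAddOrder_iff_zsmul_eq_zero]
    refine ⟨d, hd, ?_⟩
    rw [← QuotientAddGroup.mk_zsmul, QuotientAddGroup.eq_zero_iff, hmem, zsmul_eq_mul]
    have : (d : 𝓞 K) * y = aeval θ P := by
      apply RingOfIntegers.coe_injective
      rw [map_mul, map_intCast, hP, aeval_algebraMap_apply]
    exact this ▸ aeval_mem_adjoin_singleton ℤ θ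
  have : Finite (𝓞 K ⧸ H) := AddCommGroup.finite_of_fg_isAddTorsion _ htors
  intro hdvd
  obtain ⟨y, hy⟩ := exists_prime_addOrderOf_dvd_card' (G := 𝓞 K ⧸ H) p hdvd
  induction y using QuotientAddGroup.induction_on with | H y =>
  have h0 := addOrderOf_nsmul_eq_zero (y : 𝓞 K ⧸ H)
  rw [hy, ← QuotientAddGroup.mk_nsmul, QuotientAddGroup.eq_zero_iff, hmem, nsmul_eq_mul] at h0
  rw [(QuotientAddGroup.eq_zero_iff y).2 (hmem.2 (h y h0)), addOrderOf_zero] at hy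
  exact hp.one_lt.ne hy

theorem polyDisc_eq_norm [NumberField K] (hm : f.Monic) (hirr : Irreducible f)
    (hroot : aeval θ f = 0) (hgen : Algebra.adjoin ℚ {(θ : K)} = ⊤) :
    polyDisc f = (-1) ^ (f.natDegree * (f.natDegree - 1) / 2) *
      Algebra.norm ℤ (aeval θ (derivative f)) := by
  have hrootK : aeval (θ : K) f = 0 := by rw [aeval_algebraMap_apply, hroot, map_zero]
  let φ : AdjoinRoot f →+* K := AdjoinRoot.lift (algebraMap ℤ K) (θ : K) hrootK
  have hφ (P : ℤ[X]) : φ (AdjoinRoot.mk f P) = aeval (θ : K) P := AdjoinRoot.lift_mk hrootK P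
  have hφinj : Function.Injective φ := by
    rw [injective_iff_map_eq_zero]
    intro y hy
    obtain ⟨P, rfl⟩ := AdjoinRoot.mk_surjective y
    rw [hφ, aeval_algebraMap_apply] at hy
    rw [AdjoinRoot.mk_eq_zero]
    exact dvd_of_aeval_eq_zero hm hirr hroot (RingOfIntegers.coe_injective (by simpa using hy))
  let : Algebra (AdjoinRoot f) K := φ.toAlgebra
  have hmap (y : AdjoinRoot f) : algebraMap (AdjoinRoot f) K y = φ y := rfl
  have : IsScalarTower ℤ (AdjoinRoot f) K := IsScalarTower.of_algebraMap_eq' (RingHom.ext_int _ _)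
  have : IsLocalization (Algebra.algebraMapSubmonoid (AdjoinRoot f) (nonZeroDivisors ℤ)) K := by
    rw [isLocalization_iff]
    refine ⟨?_, fun z => ?_, fun {x y} h => ⟨1, by rw [hφinj h]⟩⟩
    · rintro ⟨_, d, hd, rfl⟩
      rw [← IsScalarTower.algebraMap_apply]
      simpa using nonZeroDivisors.ne_zero hd
    · obtain ⟨d, hd, P, hP⟩ := exists_int_mul_eq_aeval hgen z
      refine ⟨(AdjoinRoot.mk f P, ⟨algebraMap ℤ _ d, d, mem_nonZeroDivisors_of_ne_zero hd, rfl⟩), ?_⟩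
      rw [← IsScalarTower.algebraMap_apply, hmap, hφ, ← hP]
      simp [mul_comm]
  let b := AdjoinRoot.powerBasis' hm
  let B : PowerBasis ℚ K :=
    { gen := θ
      dim := b.dim
      basis := b.basis.localizationLocalization ℚ (nonZeroDivisors ℤ) K
      basis_eq_pow := fun i => by
        rw [Module.Basis.localizationLocalization_apply, b.basis_eq_pow, map_pow]
        congr 1
        exact (hφ X).trans (aeval_X _) }
  have hmin : minpoly ℚ (θ : K) = f.map (algebraMap ℤ ℚ) := by
    rw [minpoly.isIntegrallyClosed_eq_field_fractions' ℚ θ.isIntegral_coe,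
      minpoly.algebraMap_eq RingOfIntegers.coe_injective,
      minpoly_eq_of_irreducible_of_monic hm hirr hroot]
  have hdisc := Algebra.discr_localizationLocalization ℤ (nonZeroDivisors ℤ) (Rₘ := ℚ) K b.basis
  have hnorm : Algebra.discr ℚ B.basis = _ := Algebra.discr_powerBasis_eq_norm ℚ B
  have hB : B.gen = θ := rfl
  rw [hB, hmin, derivative_map, aeval_map_algebraMap, aeval_algebraMap_apply,
    ← Algebra.coe_norm_int, B.finrank] at hnorm
  have h := hdisc.symm.trans hnorm
  rw [polyDisc, dif_pos hm]
  apply Int.cast_injective (α := ℚ)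
  push_cast
  exact h

theorem not_dvd_polyDisc [NumberField K] (hm : f.Monic) (hirr : Irreducible f)
    (hroot : aeval θ f = 0) (hgen : Algebra.adjoin ℚ {(θ : K)} = ⊤) {p : ℕ} (hp : p.Prime)
    (hsep : (f.map (Int.castRingHom (ZMod p))).Separable) : ¬ (p : ℤ) ∣ polyDisc f := by
  obtain ⟨u, v, huv⟩ := hsep
  obtain ⟨V, rfl⟩ := Polynomial.map_surjective (Int.castRingHom (ZMod p))
    (ZMod.ringHom_surjective _) v
  obtain ⟨Q, S, hQS⟩ := exists_eq_mul_add_of_map_dvd (p := p) (g := f)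
    (P := 1 - V * derivative f) ⟨u, by
      rw [Polynomial.map_sub, Polynomial.map_one, Polynomial.map_mul, ← derivative_map]
      linear_combination -huv⟩
  have h1 : aeval θ V * aeval θ (derivative f) = 1 + p * -aeval θ S := by
    have := congrArg (aeval θ) hQS
    simp only [map_sub, map_one, map_mul, map_add, map_natCast, hroot] at this
    linear_combination -this
  intro hdvd
  refine not_dvd_norm_one_add_mul hp (-aeval θ S) ?_
  rw [polyDisc_eq_norm hm hirr hroot hgen,
    ((isUnit_one.neg.pow _).dvd_mul_left : _ ∣ (-1 : ℤ) ^ _ * _ ↔ _)] at hdvd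
  rw [← h1, map_mul]
  exact hdvd.mul_left _

end Root

theorem separable_X_pow_add_X_add_one (m : ℕ) (hm : m ≠ 0) :
    (X ^ m + X + 1 : (ZMod 2)[X]).Separable := by
  have h2 : (2 : (ZMod 2)[X]) = 0 := by
    have := CharP.cast_eq_zero (ZMod 2)[X] 2
    exact_mod_cast this
  obtain ⟨k, rfl⟩ := Nat.exists_eq_succ_of_ne_zero hm
  rw [separable_def]
  simp only [derivative_add, derivative_X_pow, derivative_X, derivative_one, Nat.succ_eq_add_one,
    add_tsub_cancel_right, add_zero]
  obtain ⟨j, rfl | rfl⟩ := Nat.even_or_odd' k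
  · refine ⟨1, -X, ?_⟩
    simp only [map_natCast]
    push_cast
    linear_combination (-(X * j * X ^ (2 * j))) * h2
  · refine ⟨0, 1, ?_⟩
    simp only [map_natCast]
    push_cast
    linear_combination ((j + 1) * X ^ (2 * j + 1)) * h2

theorem separable_X_pow_add_X_sq_add_one {n : ℕ} (hn : Odd n) (hn3 : 3 ≤ n) :
    (X ^ n + X ^ 2 + 1 : (ZMod 2)[X]).Separable := by
  have h2 : (2 : (ZMod 2)[X]) = 0 := by
    have := CharP.cast_eq_zero (ZMod 2)[X] 2
    exact_mod_cast this
  obtain ⟨k, rfl⟩ := hn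
  rw [separable_def]
  have hd : derivative (X ^ (2 * k + 1) + X ^ 2 + 1 : (ZMod 2)[X]) = X ^ (2 * k) := by
    simp only [derivative_add, derivative_X_pow, derivative_one, map_natCast]
    push_cast
    linear_combination (k * X ^ (2 * k) + X) * h2
  rw [hd]
  refine IsCoprime.pow_right ⟨1, - (X ^ (2 * k) + X), by ring⟩

theorem isCoprime_X_pow_add_X_add_one {R : Type*} [CommRing R] {m : ℕ} (hm : m ≠ 0) :
    IsCoprime (X ^ m + X + 1 : R[X]) (X ^ m * (X + 1)) := by
  refine IsCoprime.mul_right (IsCoprime.pow_right ?_) ?_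
  · obtain ⟨j, rfl⟩ := Nat.exists_eq_succ_of_ne_zero hm
    exact ⟨1, -(X ^ j + 1), by rw [pow_succ]; ring⟩
  · have h : IsCoprime (X ^ m : R[X]) (X + 1) := IsCoprime.pow_left ⟨-1, 1, by ring⟩
    rw [add_assoc]
    simpa using h.add_mul_left_left 1

theorem stmt_3 (n : ℕ) (hn : 3 ≤ n) (a b c : ℤ) (habc : b ^ 2 = 4 * a * c)
    (f : Polynomial ℤ) (hf : f = X ^ n + C a * X ^ 2 + C b * X + C c)
    (hirr : Irreducible f)
    (K : Type*) [Field K] [NumberField K] (θ : 𝓞 K)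
    (hroot : Polynomial.aeval (θ : K) f = 0)
    (hgen : Algebra.adjoin ℚ {(θ : K)} = ⊤)
    (hpD : (2 : ℤ) ∣ polyDisc f) (hpac : ¬ (2 : ℤ) ∣ a * c) :
    ¬ (2 ∣ polyIndex θ) ↔ (a ≡ 1 [ZMOD 4] ∨ c ≡ 1 [ZMOD 4]) := by
  have hf' : f = X ^ n + (C a * X ^ 2 + C b * X + C c) := by rw [hf]; ring
  have hdlt : (C a * X ^ 2 + C b * X + C c).degree < ((n : ℕ) : WithBot ℕ) :=
    degree_quadratic_le.trans_lt (by exact_mod_cast hn)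
  have hm : f.Monic := hf' ▸ monic_X_pow_add hdlt
  have hdeg : f.degree = n := by rw [hf', degree_add_eq_left_of_degree_lt] <;> rw [degree_X_pow]; exact hdlt
  have hroot' : aeval θ f = 0 := by
    apply RingOfIntegers.coe_injective
    rw [map_zero, ← aeval_algebraMap_apply]
    exact hroot
  obtain ⟨d, rfl⟩ : (2 : ℤ) ∣ b :=
    Int.prime_two.dvd_of_dvd_pow (n := 2) ⟨2 * a * c, by rw [habc]; ring⟩
  have hd : d ^ 2 = a * c := by linarith
  have hdo : Odd d := by
    rw [← Int.not_even_iff_odd, even_iff_two_dvd]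
    intro h
    exact hpac (hd ▸ dvd_pow h two_ne_zero)
  have hao : Odd a := by
    rw [← Int.not_even_iff_odd, even_iff_two_dvd]
    exact fun h => hpac (h.mul_right c)
  have hco : Odd c := by
    rw [← Int.not_even_iff_odd, even_iff_two_dvd]
    exact fun h => hpac (h.mul_left a)
  have h2 : (2 : (ZMod 2)[X]) = 0 := by
    have := CharP.cast_eq_zero (ZMod 2)[X] 2
    exact_mod_cast this
  have hne : Even n := by
    by_contra hodd
    rw [Nat.not_even_iff_odd] at hodd
    refine not_dvd_polyDisc hm hirr hroot' hgen Nat.prime_two ?_ hpD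
    suffices h : f.map (Int.castRingHom (ZMod 2)) = X ^ n + X ^ 2 + 1 by
      rw [h]; exact separable_X_pow_add_X_sq_add_one hodd hn
    obtain ⟨a', rfl⟩ := hao
    obtain ⟨c', rfl⟩ := hco
    rw [hf]
    simp
    linear_combination ((a' : (ZMod 2)[X]) * X ^ 2 + d * X + c') * h2
  obtain ⟨m, rfl⟩ := hne.two_dvd
  have hX : (X + 1 : ℤ[X]).degree = 1 := degree_X_add_C 1
  have hg : (X ^ m + X + 1 : ℤ[X]).Monic := by
    rw [add_assoc]
    refine monic_X_pow_add ?_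
    rw [hX]
    exact_mod_cast (by lia : 1 < m)
  obtain ⟨e, rfl⟩ := hdo
  have hac : a ≡ 1 [ZMOD 4] ∧ c ≡ 1 [ZMOD 4] ∨ a ≡ 3 [ZMOD 4] ∧ c ≡ 3 [ZMOD 4] := by
    have h1 : (a * c) % 4 = 1 := by
      rw [← hd, show (2 * e + 1) ^ 2 = 1 + 4 * (e ^ 2 + e) by ring, Int.add_mul_emod_self_left]
      norm_num
    have ha : a % 4 = 1 ∨ a % 4 = 3 := by obtain ⟨k, rfl⟩ := hao; lia
    have hc : c % 4 = 1 ∨ c % 4 = 3 := by obtain ⟨k, rfl⟩ := hco; lia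
    rw [Int.mul_emod] at h1
    rcases ha with ha | ha <;> rcases hc with hc | hc <;> simp_all [Int.ModEq]
  rcases hac with ⟨ha, hc⟩ | ⟨ha, hc⟩
  · refine iff_of_true (not_dvd_polyIndex hgen Nat.prime_two fun β => ?_) (Or.inl ha)
    obtain ⟨k, hk⟩ := ha.symm.dvd
    obtain ⟨l, hl⟩ := hc.symm.dvd
    obtain rfl : a = 1 + 4 * k := by linarith
    obtain rfl : c = 1 + 4 * l := by linarith
    refine mem_adjoin_of_mul_mem_adjoin hm hirr hroot' Nat.prime_two (g := X ^ m + X + 1)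
      (F := 2 * (C k * X ^ 2 + C e * X + C l) - X ^ m * (X + 1)) ?_ ?_ ?_
    · rw [hf]; simp; ring
    · simpa using (separable_X_pow_add_X_add_one m (by lia)).squarefree
    · simp only [Polynomial.map_add, Polynomial.map_sub, Polynomial.map_mul, Polynomial.map_pow,
        map_X, Polynomial.map_one, Polynomial.map_ofNat, h2, zero_mul, zero_sub]
      exact (isCoprime_X_pow_add_X_add_one (by lia)).neg_right
  · refine iff_of_false (not_not.2 ?_) ?_
    · obtain ⟨k, hk⟩ := ha.symm.dvd
      obtain ⟨l, hl⟩ := hc.symm.dvd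
      obtain rfl : a = 3 + 4 * k := by linarith
      obtain rfl : c = 3 + 4 * l := by linarith
      refine dvd_polyIndex hm hirr hroot' Nat.prime_two hg (q := -(X + 1))
        (r := C (k + 1) * X ^ 2 + C (e + 1) * X + C (l + 1)) ?_ ?_
      · rw [add_assoc, degree_add_eq_left_of_degree_lt, hdeg, degree_X_pow]
        · exact_mod_cast (by lia : m < 2 * m)
        · rw [hX, degree_X_pow]
          exact_mod_cast (by lia : 1 < m)
      · rw [hf]; simp; ring
    · rintro (h | h)
      · have := ha.symm.trans h
        revert this; decide
      · have := hc.symm.trans h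
        revert this; decide
end

section
/- Let f(x) = x^n + a·x^2 + b·x + c ∈ ℤ[x] be an irreducible polynomial of degree n ≥ 3 with b^2 = 4·a·c, let θ be a root of f, K = ℚ(θ), and ℤ_K the ring of integers of K. If p is a prime dividing the discriminant D_f of f with p not dividing b, then p does not divide the index [ℤ_K : ℤ[θ]] if and only if p^2 does not divide D_f. -/
open Polynomial NumberField

open Module

section Discriminant

/-- A ring homomorphism carrying a basis to a basis preserves discriminants. -/
lemma Algebra.discr_eq_of_map_basis {ι R S A B : Type*} [Fintype ι] [DecidableEq ι] [CommRing R]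
    [CommRing S] [CommRing A] [CommRing B] [Algebra R A] [Algebra S B] [Algebra R S]
    [Algebra R B] [IsScalarTower R S B] (b : Basis ι R A) (b' : Basis ι S B)
    (φ : A →ₐ[R] B) (h : ∀ i, φ (b i) = b' i) :
    Algebra.discr S b' = algebraMap R S (Algebra.discr R b) := by
  have hrepr (x : A) (i : ι) : b'.repr (φ x) i = algebraMap R S (b.repr x i) := by
    have hx : φ x = ∑ j, algebraMap R S (b.repr x j) • b' j := by
      calc φ x = φ (∑ j, b.repr x j • b j) := by rw [b.sum_repr]
        _ = _ := by rw [map_sum]; simp [h]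
    rw [hx, Basis.repr_sum_self]
  have htr (x : A) : Algebra.trace S B (φ x) = algebraMap R S (Algebra.trace R A x) := by
    rw [Algebra.trace_eq_matrix_trace b', Algebra.trace_eq_matrix_trace b, Matrix.trace,
      Matrix.trace, map_sum]
    refine Finset.sum_congr rfl fun i _ ↦ ?_
    simp [Matrix.diag, Algebra.leftMulMatrix_eq_repr_mul, ← h, ← map_mul, hrepr]
  rw [Algebra.discr_def, Algebra.discr_def, RingHom.map_det]
  congr 1
  ext i j
  simp [Algebra.traceMatrix_apply, Algebra.traceForm_apply, ← h, ← map_mul, htr]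

variable {K : Type*} [Field K] [NumberField K] {θ : 𝓞 K}

lemma polyDisc_minpoly_eq (θ : 𝓞 K) :
    polyDisc (minpoly ℤ θ) =
      Algebra.discr ℤ (Algebra.adjoin.powerBasis' (RingOfIntegers.isIntegral θ)).basis := by
  have hθ := RingOfIntegers.isIntegral θ
  rw [polyDisc, dif_pos (minpoly.monic hθ),
    Algebra.discr_eq_discr_of_algEquiv _ (minpoly.equivAdjoin hθ)]
  congr 1

lemma minpoly_rat_eq_map (θ : 𝓞 K) :
    minpoly ℚ (θ : K) = (minpoly ℤ θ).map (algebraMap ℤ ℚ) := by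
  rw [← NumberField.RingOfIntegers.minpoly_coe]
  exact minpoly.isIntegrallyClosed_eq_field_fractions' ℚ θ.isIntegral_coe

lemma exists_powerBasis_gen_eq (hgen : Algebra.adjoin ℚ {(θ : K)} = ⊤) :
    ∃ pb : PowerBasis ℚ K, pb.gen = θ :=
  ⟨PowerBasis.ofAdjoinEqTop (Algebra.IsIntegral.isIntegral _) hgen, by simp⟩

lemma PowerBasis.dim_eq_natDegree_minpoly_int (pb : PowerBasis ℚ K) (h : pb.gen = θ) :
    pb.dim = (minpoly ℤ θ).natDegree := by
  rw [← pb.natDegree_minpoly, h, minpoly_rat_eq_map,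
    (minpoly.monic (RingOfIntegers.isIntegral θ)).natDegree_map]

lemma discr_powerBasis_eq_polyDisc (pb : PowerBasis ℚ K) (h : pb.gen = θ) :
    Algebra.discr ℚ pb.basis = polyDisc (minpoly ℤ θ) := by
  have hdim : pb.dim = (Algebra.adjoin.powerBasis' (RingOfIntegers.isIntegral θ)).dim :=
    pb.dim_eq_natDegree_minpoly_int h
  rw [polyDisc_minpoly_eq, ← Algebra.discr_reindex ℚ pb.basis (finCongr hdim),
    ← Basis.coe_reindex]
  refine Algebra.discr_eq_of_map_basis _ _
    ((IsScalarTower.toAlgHom ℤ (𝓞 K) K).comp (Algebra.adjoin ℤ {θ}).val) fun i ↦ ?_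
  rw [PowerBasis.basis_eq_pow, Basis.reindex_apply, PowerBasis.basis_eq_pow]
  simp [h]
  rfl

/-- Up to sign, the discriminant of the minimal polynomial `f` of a generator `θ` is the norm of
the derivative of `f` at `θ`. -/
lemma associated_polyDisc_norm (hgen : Algebra.adjoin ℚ {(θ : K)} = ⊤) :
    Associated (polyDisc (minpoly ℤ θ))
      (Algebra.norm ℤ (aeval θ (derivative (minpoly ℤ θ)))) := by
  obtain ⟨pb, h⟩ := exists_powerBasis_gen_eq hgen
  have key := Algebra.discr_powerBasis_eq_norm ℚ pb
  rw [discr_powerBasis_eq_polyDisc pb h, h, minpoly_rat_eq_map, derivative_map,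
    aeval_map_algebraMap, aeval_algebraMap_apply, ← Algebra.coe_norm_int] at key
  norm_cast at key
  rw [key, mul_comm]
  exact (associated_mul_unit_left _ _ (isUnit_neg_one.pow _))

lemma discr_int_eq_discr_rat {ι : Type*} [Fintype ι] [DecidableEq ι] (v : ι → 𝓞 K) :
    (Algebra.discr ℤ v : ℚ) = Algebra.discr ℚ fun i ↦ (v i : K) := by
  rw [Algebra.discr_def, Algebra.discr_def, ← eq_intCast (Int.castRingHom ℚ), RingHom.map_det]
  congr 1
  ext i j
  simp [Algebra.traceMatrix_apply, Algebra.traceForm_apply, Algebra.coe_trace_int]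

/-- The discriminant of an order `ℤ[θ]` of full rank is the discriminant of the field times the
square of the index. -/
lemma polyDisc_minpoly_eq_index_sq_mul_discr (hgen : Algebra.adjoin ℚ {(θ : K)} = ⊤) :
    polyDisc (minpoly ℤ θ) = (polyIndex θ : ℤ) ^ 2 * NumberField.discr K := by
  obtain ⟨pb, h⟩ := exists_powerBasis_gen_eq hgen
  let pbS := Algebra.adjoin.powerBasis' (RingOfIntegers.isIntegral θ)
  have hdim : pb.dim = pbS.dim := pb.dim_eq_natDegree_minpoly_int h
  let bE : Basis (Fin pbS.dim) ℤ (𝓞 K) := (RingOfIntegers.basis K).reindex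
    (((integralBasis K).indexEquiv pb.basis).trans (finCongr hdim))
  let N := (Algebra.adjoin ℤ {θ}).toSubring.toAddSubgroup
  let e : Algebra.adjoin ℤ {θ} ≃+ N :=
    { toFun := fun x ↦ ⟨x.1, x.2⟩, invFun := fun x ↦ ⟨x.1, x.2⟩, map_add' := fun _ _ ↦ rfl }
  let v : Fin pbS.dim → 𝓞 K := fun i ↦ θ ^ (i : ℕ)
  have hv : (fun i ↦ ((pbS.basis.map e.toIntLinearEquiv i : N) : 𝓞 K)) = v := by
    ext1 i
    change ((pbS.basis i : Algebra.adjoin ℤ {θ}) : 𝓞 K) = _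
    rw [pbS.basis_eq_pow i]
    simp [pbS, v]
  have hindex : ((polyIndex θ : ℕ) : ℤ) ^ 2 = (bE.toMatrix v).det ^ 2 := by
    rw [polyIndex, AddSubgroup.index_eq_natAbs_det bE N (pbS.basis.map e.toIntLinearEquiv), hv,
      Int.natCast_natAbs, sq_abs, Basis.det_apply]
  have hdiscr : Algebra.discr ℤ v = polyDisc (minpoly ℤ θ) := by
    rw [← Int.cast_inj (α := ℚ), discr_int_eq_discr_rat, ← discr_powerBasis_eq_polyDisc pb h,
      ← Algebra.discr_reindex ℚ pb.basis (finCongr hdim)]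
    congr 1
    ext i
    simp [v, h]
  rw [← hdiscr, hindex, ← NumberField.discr_eq_discr K bE, ← Algebra.discr_of_matrix_vecMul,
    Basis.toMatrix_map_vecMul]

/-- For `f` the minimal polynomial of a generator `θ`, the norm of `m θ - k` is up to
sign the value at `(k, m)` of the homogenization of `f`. -/
lemma norm_intCast_mul_sub (hgen : Algebra.adjoin ℚ {(θ : K)} = ⊤) {m : ℤ} (hm : m ≠ 0) (k : ℤ) :
    (Algebra.norm ℤ ((m : 𝓞 K) * θ - k) : ℚ) =
      (-m) ^ (minpoly ℤ θ).natDegree * aeval (k / m : ℚ) (minpoly ℤ θ) := by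
  obtain ⟨pb, h⟩ := exists_powerBasis_gen_eq hgen
  have hn : Algebra.norm ℚ (algebraMap ℚ K (k / m) - θ) = aeval (k / m : ℚ) (minpoly ℤ θ) := by
    rw [← aeval_map_algebraMap ℚ, ← minpoly_rat_eq_map, ← h, ← charpoly_leftMulMatrix,
      Algebra.norm_eq_matrix_det pb.basis, coe_aeval_eq_eval, Matrix.eval_charpoly, map_sub,
      AlgHom.commutes]
    rfl
  have he : (((m : 𝓞 K) * θ - k : 𝓞 K) : K) =
      algebraMap ℚ K (-m) * (algebraMap ℚ K (k / m) - θ) := by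
    have : (m : K) ≠ 0 := by exact_mod_cast hm
    simp
    field_simp
    ring
  rw [Algebra.coe_norm_int, he, map_mul, hn, Algebra.norm_algebraMap, pb.finrank,
    pb.dim_eq_natDegree_minpoly_int h]

end Discriminant

section Index

variable {K : Type*} [Field K] [NumberField K] {θ : 𝓞 K} {p : ℕ}

lemma dvd_polyIndex_of_mul_mem (hp : p.Prime) {α : 𝓞 K} (hα : α ∉ Algebra.adjoin ℤ {θ})
    (hpα : (p : 𝓞 K) * α ∈ Algebra.adjoin ℤ {θ}) : p ∣ polyIndex θ := by
  have := Fact.mk hp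
  set N := (Algebra.adjoin ℤ {θ}).toSubring.toAddSubgroup with hN
  have hord : addOrderOf (α : 𝓞 K ⧸ N) = p := by
    refine addOrderOf_eq_prime ?_ ?_
    · rw [← QuotientAddGroup.mk_nsmul, QuotientAddGroup.eq_zero_iff, nsmul_eq_mul]
      exact hpα
    · rw [Ne, QuotientAddGroup.eq_zero_iff]
      exact hα
  rw [polyIndex, ← hN, AddSubgroup.index, ← hord]
  exact addOrderOf_dvd_natCard _

/-- If the minimal polynomial of `θ` has a double root `t` modulo `p` at which its value is
divisible by `p²`, then `ℤ[θ]` is not maximal at `p`. -/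
lemma dvd_polyIndex_of_sq_dvd_eval (hp : p.Prime) {t : ℤ}
    (h0 : (p : ℤ) ^ 2 ∣ (minpoly ℤ θ).eval t)
    (h1 : (p : ℤ) ∣ (derivative (minpoly ℤ θ)).eval t) : p ∣ polyIndex θ := by
  have := Fact.mk hp
  have hθ := RingOfIntegers.isIntegral θ
  set f := minpoly ℤ θ with hfdef
  obtain ⟨q, hq⟩ := X_sub_C_dvd_sub_C_eval (a := t) (p := f)
  obtain ⟨h, hh⟩ := X_sub_C_dvd_sub_C_eval (a := t) (p := q)
  have hqt : q.eval t = (derivative f).eval t := by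
    rw [← sub_eq_zero]
    have := congrArg (fun g ↦ (derivative g).eval t) hq
    simp at this
    simp [this]
  have hf : f = (X - C t) ^ 2 * h + C ((derivative f).eval t) * (X - C t) + C (f.eval t) := by
    rw [← hqt]
    linear_combination hq + (X - C t) * hh
  obtain ⟨v, hv⟩ := h0
  obtain ⟨u, hu⟩ := h1
  rw [hu, hv] at hf
  have hp0 : (p : K) ≠ 0 := by exact_mod_cast hp.ne_zero
  set π : 𝓞 K := θ - t with hπ
  set η : 𝓞 K := aeval θ h with hη
  have hrel : π ^ 2 * η + p * u * π + p ^ 2 * v = 0 := by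
    have := congrArg (aeval θ) hf
    rw [hfdef, minpoly.aeval] at this
    rw [hπ, hη, this]
    simp
  have hrelK : (π : K) ^ 2 * η + p * u * π + p ^ 2 * v = 0 := by
    have := congrArg (algebraMap (𝓞 K) K) hrel
    simpa using this
  have hint : IsIntegral (𝓞 K) ((π : K) * η / p) := by
    refine ⟨X ^ 2 + C (u : 𝓞 K) * X + C (v * η), ?_, ?_⟩
    · monicity!
    · simp only [eval₂_add, eval₂_pow, eval₂_mul, eval₂_X, eval₂_C]
      simp only [map_mul, map_intCast]
      field_simp
      linear_combination (η : K) * hrelK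
  obtain ⟨α, hα⟩ := IsIntegrallyClosed.isIntegral_iff.mp hint
  have hpα : (p : 𝓞 K) * α = π * η := by
    apply RingOfIntegers.coe_injective
    simp [hα]
    field_simp
  refine dvd_polyIndex_of_mul_mem hp (α := α) ?_ ?_
  · intro hmem
    rw [Algebra.adjoin_singleton_eq_range_aeval] at hmem
    obtain ⟨g, hg⟩ := hmem
    have hdvd : f ∣ (X - C t) * h - C (p : ℤ) * g := by
      rw [hfdef, ← minpoly.isIntegrallyClosed_dvd_iff hθ]
      have : aeval θ g = α := hg
      simp [this, hpα, hπ, hη]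
    have hdvd' := Polynomial.map_dvd (Int.castRingHom (ZMod p)) hdvd
    have hfmap : f.map (Int.castRingHom (ZMod p)) = (X - C (t : ZMod p)) *
        ((X - C (t : ZMod p)) * h.map (Int.castRingHom (ZMod p))) := by
      conv_lhs => rw [hf]
      simp
      ring
    have hne : (X - C (t : ZMod p)) * h.map (Int.castRingHom (ZMod p)) ≠ 0 := by
      intro h0
      rw [h0, mul_zero] at hfmap
      exact ((minpoly.monic hθ).map _).ne_zero hfmap
    rw [hfmap] at hdvd'
    have hmap : ((X - C t) * h - C (p : ℤ) * g).map (Int.castRingHom (ZMod p)) =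
        1 * ((X - C (t : ZMod p)) * h.map (Int.castRingHom (ZMod p))) := by
      simp
    rw [hmap, mul_dvd_mul_iff_right hne] at hdvd'
    exact not_isUnit_X_sub_C _ (isUnit_of_dvd_one hdvd')
  · rw [hpα, Algebra.adjoin_singleton_eq_range_aeval]
    exact ⟨(X - C t) * h, by simp [hπ, hη]⟩

end Index

section Quadrinomial

lemma monic_quadrinomial {n : ℕ} (hn : 3 ≤ n) (a b c : ℤ) :
    (X ^ n + C a * X ^ 2 + C b * X + C c).Monic := by
  obtain ⟨n, rfl⟩ := Nat.exists_eq_add_of_le' hn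
  monicity!

variable {K : Type*} [Field K] [NumberField K] {θ : 𝓞 K}

lemma minpoly_int_eq_of_irreducible {f : ℤ[X]} (hf : f.Monic) (hirr : Irreducible f)
    (hroot : aeval (θ : K) f = 0) : minpoly ℤ θ = f := by
  have hθ := RingOfIntegers.isIntegral θ
  have h0 : aeval θ f = 0 := by
    apply RingOfIntegers.coe_injective
    rw [← aeval_algebraMap_apply, hroot, map_zero]
  have hdvd := minpoly.isIntegrallyClosed_dvd hθ h0
  exact eq_of_monic_of_associated (minpoly.monic hθ) hf
    ((minpoly.irreducible hθ).associated_of_dvd hirr hdvd)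

/-- The norm of `m θ - k` for a root `θ` of the quadrinomial `X ^ n + a X² + b X + c`. -/
lemma associated_norm_intCast_mul_sub (hgen : Algebra.adjoin ℚ {(θ : K)} = ⊤) {n : ℕ} (hn : 3 ≤ n)
    {a b c : ℤ} (hmin : minpoly ℤ θ = X ^ n + C a * X ^ 2 + C b * X + C c) {m : ℤ} (hm : m ≠ 0)
    (k : ℤ) :
    Associated (Algebra.norm ℤ ((m : 𝓞 K) * θ - k))
      (k ^ n + a * k ^ 2 * m ^ (n - 2) + b * k * m ^ (n - 1) + c * m ^ n) := by
  have hdeg : (minpoly ℤ θ).natDegree = n := by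
    rw [hmin]
    compute_degree!
    all_goals grind
  have key := norm_intCast_mul_sub hgen hm k
  rw [hdeg, hmin] at key
  have hm' : (m : ℚ) ≠ 0 := by exact_mod_cast hm
  obtain ⟨n, rfl⟩ := Nat.exists_eq_add_of_le' hn
  have : Algebra.norm ℤ ((m : 𝓞 K) * θ - k) = (-1) ^ (n + 3) *
      (k ^ (n + 3) + a * k ^ 2 * m ^ (n + 1) + b * k * m ^ (n + 2) + c * m ^ (n + 3)) := by
    rw [← Int.cast_inj (α := ℚ), key, neg_pow]
    simp [div_pow]
    field_simp
    ring
  rw [this, mul_comm]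
  exact associated_mul_unit_left _ _ (isUnit_neg_one.pow _)

/-- If `p² ∣ k ^ n + a k² m ^ (n - 2) + b k m ^ (n - 1) + c m ^ n`, where `m, k` are given by the
rational number `-n b / (2 a (n - 2))`, then this number has an integral approximation modulo `p²`
which is a double root modulo `p` of `f`, and at which `p² ∣ f`. -/
lemma exists_double_root {n : ℕ} (hn : 3 ≤ n) {a b c : ℤ} (habc : b ^ 2 = 4 * a * c) {p : ℕ}
    (hp : p.Prime) (hpb : ¬ (p : ℤ) ∣ b) {m k : ℤ} (hm : m = 2 * (2 - n) * a) (hk : k = n * b)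
    (h : (p : ℤ) ^ 2 ∣ k ^ n + a * k ^ 2 * m ^ (n - 2) + b * k * m ^ (n - 1) + c * m ^ n) :
    ∃ t : ℤ, (p : ℤ) ^ 2 ∣ (X ^ n + C a * X ^ 2 + C b * X + C c : ℤ[X]).eval t ∧
      (p : ℤ) ∣ (derivative (X ^ n + C a * X ^ 2 + C b * X + C c : ℤ[X])).eval t := by
  have hpp := Nat.prime_iff_prime_int.mp hp
  have h4a : ¬ (p : ℤ) ∣ 4 * a := fun h ↦
    hpb (hpp.dvd_of_dvd_pow (habc ▸ h.mul_right c))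
  have hc : ¬ (p : ℤ) ∣ c := fun h ↦
    hpb (hpp.dvd_of_dvd_pow (habc ▸ h.mul_left (4 * a)))
  obtain ⟨n, rfl⟩ := Nat.exists_eq_add_of_le' hn
  simp only [show n + 3 - 2 = n + 1 by lia, show n + 3 - 1 = n + 2 by lia] at h
  have hpm : ¬ (p : ℤ) ∣ m := by
    intro hpm
    have h1 : (p : ℤ) ∣ k ^ (n + 3) := by
      have h2 := (dvd_pow_self (p : ℤ) two_ne_zero).trans h
      have h3 : (p : ℤ) ∣ m * (a * k ^ 2 * m ^ n + b * k * m ^ (n + 1) + c * m ^ (n + 2)) :=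
        hpm.mul_right _
      convert! dvd_sub h2 h3 using 1
      ring
    have h2 : (p : ℤ) ∣ ((n + 3 : ℕ) : ℤ) :=
      (hpp.dvd_or_dvd (hk ▸ hpp.dvd_of_dvd_pow h1)).resolve_right hpb
    apply h4a
    convert! dvd_add hpm (h2.mul_right (2 * a)) using 1
    rw [hm]
    ring
  have hcop : IsCoprime m ((p : ℤ) ^ 2) := ((hpp.coprime_iff_not_dvd.mpr hpm).symm).pow_right
  obtain ⟨r, s, hrs⟩ := hcop
  obtain ⟨t, ht⟩ : ∃ t, t = r * k := ⟨_, rfl⟩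
  have hmt : (p : ℤ) ^ 2 ∣ m * t - k := ⟨-s * k, by rw [ht]; linear_combination k * hrs⟩
  have hpmt : (p : ℤ) ∣ m * t - k := (dvd_pow_self (p : ℤ) two_ne_zero).trans hmt
  have hft : (p : ℤ) ^ 2 ∣ t ^ (n + 3) + a * t ^ 2 + b * t + c := by
    have hcop : IsCoprime ((p : ℤ) ^ 2) (m ^ (n + 3)) :=
      (hpp.coprime_iff_not_dvd.mpr hpm).pow
    refine hcop.dvd_of_dvd_mul_left ?_
    have h1 := hmt.trans (sub_dvd_pow_sub_pow (m * t) k (n + 3))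
    have h2 := hmt.trans (sub_dvd_pow_sub_pow (m * t) k 2)
    convert! dvd_add (dvd_add (dvd_add h h1) (h2.mul_left (a * m ^ (n + 1))))
      (hmt.mul_left (b * m ^ (n + 2))) using 1
    ring
  refine ⟨t, by simpa using hft, ?_⟩
  have hpft := (dvd_pow_self (p : ℤ) two_ne_zero).trans hft
  have hpt : ¬ (p : ℤ) ∣ t := by
    intro hpt
    apply hc
    convert! dvd_sub hpft (hpt.mul_right (t ^ (n + 2) + a * t + b)) using 1
    ring
  refine (hpp.dvd_or_dvd (a := 4 * a * t) ?_).resolve_left fun h ↦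
    (hpp.dvd_or_dvd h).elim h4a hpt
  convert! dvd_add (hpft.mul_left (4 * a * (n + 3))) (hpmt.mul_left (2 * a * t + b)) using 1
  simp [hm, hk]
  linear_combination ((n : ℤ) + 3) * habc

end Quadrinomial

theorem stmt_4 (n : ℕ) (hn : 3 ≤ n) (a b c : ℤ) (habc : b ^ 2 = 4 * a * c)
    (f : Polynomial ℤ) (hf : f = X ^ n + C a * X ^ 2 + C b * X + C c)
    (hirr : Irreducible f)
    (K : Type*) [Field K] [NumberField K] (θ : 𝓞 K)
    (hroot : Polynomial.aeval (θ : K) f = 0)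
    (hgen : Algebra.adjoin ℚ {(θ : K)} = ⊤)
    (p : ℕ) (hp : p.Prime) (hpD : (p : ℤ) ∣ polyDisc f) (hpb : ¬ (p : ℤ) ∣ b) :
    ¬ (p ∣ polyIndex θ) ↔ ¬ ((p : ℤ) ^ 2 ∣ polyDisc f) := by
  have hmin : minpoly ℤ θ = f :=
    minpoly_int_eq_of_irreducible (hf ▸ monic_quadrinomial hn a b c) hirr hroot
  have hpp := Nat.prime_iff_prime_int.mp hp
  refine not_congr ⟨fun h ↦ ?_, fun h ↦ ?_⟩
  · rw [← hmin, polyDisc_minpoly_eq_index_sq_mul_discr hgen]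
    exact (pow_dvd_pow_of_dvd (Int.natCast_dvd_natCast.mpr h) 2).mul_right _
  rw [← hmin, (associated_polyDisc_norm hgen).dvd_iff_dvd_right, hmin] at h
  have h4a : ¬ (p : ℤ) ∣ 4 * a := fun h ↦
    hpb (hpp.dvd_of_dvd_pow (habc ▸ h.mul_right c))
  have hc : ¬ (p : ℤ) ∣ c := fun h ↦
    hpb (hpp.dvd_of_dvd_pow (habc ▸ h.mul_left (4 * a)))
  have ha0 : a ≠ 0 := by
    rintro rfl
    simp at h4a
  have hθ0 : θ ^ n + a * θ ^ 2 + b * θ + c = 0 := by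
    have := minpoly.aeval ℤ θ
    rw [hmin, hf] at this
    simpa using this
  have habcR : (b : 𝓞 K) ^ 2 = 4 * a * c := by exact_mod_cast habc
  set m : ℤ := 2 * (2 - n) * a with hm
  set k : ℤ := n * b with hk
  have hm0 : m ≠ 0 := by
    have : (2 - n : ℤ) ≠ 0 := by lia
    positivity
  have hderiv : ((4 * a : ℤ) : 𝓞 K) * (θ * aeval θ (derivative f)) =
      (2 * a * θ + b) * ((m : 𝓞 K) * θ - k) := by
    obtain ⟨n, rfl⟩ := Nat.exists_eq_add_of_le' hn
    simp [hf, hm, hk, map_ofNat]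
    linear_combination (4 * a * (n + 3 : 𝓞 K)) * hθ0 + (n + 3 : 𝓞 K) * habcR
  have hsq : (2 * a * θ + b) ^ 2 = ((-(4 * a) : ℤ) : 𝓞 K) * θ ^ n := by
    push_cast
    linear_combination 4 * a * hθ0 + habcR
  have hnθ : ¬ (p : ℤ) ∣ Algebra.norm ℤ θ := by
    have := associated_norm_intCast_mul_sub hgen hn (hmin.trans hf) one_ne_zero 0
    obtain ⟨n, rfl⟩ := Nat.exists_eq_add_of_le' hn
    simp at this
    rwa [this.dvd_iff_dvd_right]
  have hnint (z : ℤ) (hz : ¬ (p : ℤ) ∣ z) : ¬ (p : ℤ) ∣ Algebra.norm ℤ (z : 𝓞 K) := by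
    rw [← eq_intCast (algebraMap ℤ (𝓞 K)), Algebra.norm_algebraMap]
    exact fun h ↦ hz (hpp.dvd_of_dvd_pow h)
  have hnlin : ¬ (p : ℤ) ∣ Algebra.norm ℤ (2 * a * θ + b) := by
    intro h
    have := h.trans (dvd_pow_self _ two_ne_zero)
    rw [← map_pow, hsq, map_mul, map_pow] at this
    exact (hpp.dvd_or_dvd this).elim (hnint _ (by rwa [dvd_neg]))
      fun h ↦ hnθ (hpp.dvd_of_dvd_pow h)
  have hnG : (p : ℤ) ^ 2 ∣ Algebra.norm ℤ ((m : 𝓞 K) * θ - k) := by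
    refine IsCoprime.dvd_of_dvd_mul_left ((hpp.coprime_iff_not_dvd.mpr hnlin).pow_left) ?_
    rw [← map_mul, ← hderiv, map_mul, map_mul]
    exact (h.mul_left _).mul_left _
  rw [(associated_norm_intCast_mul_sub hgen hn (hmin.trans hf) hm0 k).dvd_iff_dvd_right] at hnG
  obtain ⟨t, h0, h1⟩ := exists_double_root hn habc hp hpb hm hk hnG
  rw [← hf, ← hmin] at h0 h1
  exact dvd_polyIndex_of_sq_dvd_eval hp h0 h1
end

section
/- Let f(x) = x^n + a·x^2 + b·x + c ∈ ℤ[x] be a monic irreducible polynomial of degree n ≥ 3 with b^2 = 4·a·c, where c ≠ ±1 is squarefree, and suppose that the set of primes dividing a, the set of primes dividing b, and the set of primes dividing c coincide. Assume moreover that 2 divides c, or a ≡ 1 (mod 4), or c ≡ 1 (mod 4). Let K = ℚ(θ) with θ a root of f, and let ℤ_K be the ring of integers of K. Then ℤ_K = ℤ[θ] if and only if for each prime p dividing the discriminant D_f of f and not dividing a, p^2 does not divide D_f. -/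
open Polynomial NumberField

theorem Algebra.trace_eq_intCast_trace {A L ι : Type*} [CommRing A] [Field L] [Algebra ℚ L]
    [Fintype ι] (b : Module.Basis ι ℤ A) (b' : Module.Basis ι ℚ L)
    (φ : A →+* L) (h : ∀ i, φ (b i) = b' i) (x : A) :
    Algebra.trace ℚ L (φ x) = (Algebra.trace ℤ A x : ℚ) := by
  classical
  rw [Algebra.trace_eq_matrix_trace b, Algebra.trace_eq_matrix_trace b', Matrix.trace,
    Matrix.trace, Int.cast_sum]
  refine Finset.sum_congr rfl fun i _ => ?_
  simp only [Matrix.diag, Algebra.leftMulMatrix_eq_repr_mul]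
  have : φ x * b' i = ∑ j, (b.repr (x * b i) j : ℚ) • b' j := by
    rw [← h, ← map_mul]
    conv_lhs => rw [← b.sum_repr (x * b i), map_sum]
    refine Finset.sum_congr rfl fun j _ => ?_
    simp [h, Algebra.smul_def]
  rw [this, b'.repr_sum_self]

theorem Algebra.discr_eq_intCast_discr {A L ι : Type*} [CommRing A] [Field L] [Algebra ℚ L]
    [Fintype ι] [DecidableEq ι] (b : Module.Basis ι ℤ A) (b' : Module.Basis ι ℚ L)
    (φ : A →+* L) (h : ∀ i, φ (b i) = b' i) :
    Algebra.discr ℚ b' = (Algebra.discr ℤ b : ℚ) := by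
  rw [Algebra.discr_def, Algebra.discr_def, Int.cast_det]
  congr 1
  ext i j
  simp [Algebra.traceMatrix_apply, Algebra.traceForm_apply, ← h, ← map_mul,
    Algebra.trace_eq_intCast_trace b b' φ h]

theorem PowerBasis.norm_algebraMap_sub_gen {F L : Type*} [Field F] [Field L] [Algebra F L]
    (B : PowerBasis F L) (t : F) :
    Algebra.norm F (algebraMap F L t - B.gen) = (minpoly F B.gen).eval t := by
  rw [← charpoly_leftMulMatrix, Matrix.eval_charpoly, Algebra.norm_eq_matrix_det B.basis, map_sub,
    AlgHom.commutes]
  rfl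

theorem Algebra.discr_update {F L ι : Type*} [Field F] [Field L] [Algebra F L]
    [Fintype ι] [DecidableEq ι] (b : Module.Basis ι F L) (j : ι) (z : L) :
    Algebra.discr F (Function.update b j z) = b.repr z j ^ 2 * Algebra.discr F b := by
  have hdet : ((1 : Matrix ι ι F).updateCol j (b.repr z)).det = b.repr z j := by
    rw [← Matrix.cramer_apply, Matrix.cramer_one]; rfl
  rw [← hdet, ← Algebra.discr_of_matrix_vecMul]
  congr 1
  ext i
  rw [Matrix.vecMul, dotProduct]
  by_cases hij : i = j
  · subst hij
    simp [← Algebra.smul_def, mul_comm, b.sum_repr]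
  · simp [Function.update_of_ne hij, Matrix.updateCol_ne hij, Matrix.one_apply]

theorem PowerBasis.sq_dvd_discr_of_smul_mem_adjoin {L : Type*} [Field L] [NumberField L]
    (B : PowerBasis ℚ L) (hB : IsIntegral ℤ B.gen) {D : ℤ} (hD : Algebra.discr ℚ B.basis = D)
    {p : ℤ} (hp : Prime p) {z : L} (hz : IsIntegral ℤ z)
    (hpz : p • z ∈ Algebra.adjoin ℤ {B.gen}) (hz' : z ∉ Algebra.adjoin ℤ {B.gen}) :
    p ^ 2 ∣ D := by
  have hp0 : (p : ℚ) ≠ 0 := by exact_mod_cast hp.ne_zero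
  have hint : ∀ i, ∃ m : ℤ, B.basis.repr (p • z) i = m := by
    intro i
    rw [Algebra.adjoin_singleton_eq_range_aeval] at hpz
    obtain ⟨q, hq⟩ := hpz
    have hI : IsIntegral ℤ (B.basis.repr (p • z) i) := by
      rw [← hq]
      simp only [AlgHom.toRingHom_eq_coe, RingHom.coe_coe, aeval_eq_sum_range, map_sum,
        Finsupp.finsetSum_apply]
      refine IsIntegral.sum _ fun k _ => ?_
      rw [← Int.cast_smul_eq_zsmul ℚ, map_smul, Finsupp.smul_apply, smul_eq_mul]
      exact isIntegral_algebraMap.mul (PowerBasis.repr_gen_pow_isIntegral hB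
        (minpoly.isIntegrallyClosed_eq_field_fractions' ℚ hB) k i)
    obtain ⟨m, hm⟩ := IsIntegrallyClosed.isIntegral_iff.mp hI
    exact ⟨m, hm.symm⟩
  choose m hm using hint
  have hm' : ∀ i, (m i : ℚ) = p * B.basis.repr z i := by
    intro i
    rw [← hm, ← Int.cast_smul_eq_zsmul ℚ, map_smul]; simp
  obtain ⟨j, hj⟩ : ∃ j, ¬ p ∣ m j := by
    by_contra! hall
    choose k hk using hall
    apply hz'
    rw [← B.basis.sum_repr z]
    refine Subalgebra.sum_mem _ fun i _ => ?_
    have : B.basis.repr z i = k i := by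
      have := hm' i
      rw [hk, Int.cast_mul] at this
      exact (mul_left_cancel₀ hp0 this).symm
    rw [this, Int.cast_smul_eq_zsmul, B.basis_eq_pow]
    exact Subalgebra.zsmul_mem _ (Subalgebra.pow_mem _ (Algebra.self_mem_adjoin_singleton ℤ _) _) _
  have hI : IsIntegral ℤ (Algebra.discr ℚ (Function.update B.basis j z)) := by
    refine Algebra.discr_isIntegral ℚ fun i => ?_
    by_cases hij : i = j
    · subst hij; simpa
    · rw [Function.update_of_ne hij, B.basis_eq_pow]; exact hB.pow _
  obtain ⟨e, he⟩ := IsIntegrallyClosed.isIntegral_iff.mp hI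
  rw [Algebra.discr_update, hD] at he
  have : p ^ 2 * e = m j ^ 2 * D := by
    have : (p ^ 2 * e : ℚ) = m j ^ 2 * D := by
      rw [hm', show (e : ℚ) = _ from he]; ring
    exact_mod_cast this
  refine (IsCoprime.pow ((hp.coprime_iff_not_dvd).mpr hj)).dvd_of_dvd_mul_left ⟨e, this.symm⟩

theorem PowerBasis.mem_adjoin_of_forall_prime {L : Type*} [Field L] [NumberField L]
    (B : PowerBasis ℚ L) (hB : IsIntegral ℤ B.gen)
    (h : ∀ p : ℕ, p.Prime → ∀ z : L, IsIntegral ℤ z → (p : ℤ) • z ∈ Algebra.adjoin ℤ {B.gen} →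
      z ∈ Algebra.adjoin ℤ {B.gen})
    {D : ℤ} (hD : Algebra.discr ℚ B.basis = D) {z : L} (hz : IsIntegral ℤ z) :
    z ∈ Algebra.adjoin ℤ {B.gen} := by
  have hD0 : D ≠ 0 := by
    rintro rfl
    exact Algebra.discr_not_zero_of_basis ℚ B.basis (by simpa using hD)
  have key : ∀ N : ℕ, N ≠ 0 → ∀ z : L, IsIntegral ℤ z →
      (N : ℤ) • z ∈ Algebra.adjoin ℤ {B.gen} → z ∈ Algebra.adjoin ℤ {B.gen} := by
    intro N
    induction N using Nat.recOnMul with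
    | zero => simp
    | one => simp
    | prime p hp => exact fun _ => h p hp
    | mul a b iha ihb =>
      intro hab z hz hmem
      refine ihb (right_ne_zero_of_mul hab) z hz ?_
      refine iha (left_ne_zero_of_mul hab) _ (hz.smul _) ?_
      rwa [smul_smul, ← Nat.cast_mul]
  have hmem := Algebra.discr_mul_isIntegral_mem_adjoin ℚ hB hz
  rw [hD, Int.cast_smul_eq_zsmul] at hmem
  refine key D.natAbs (by simpa using hD0) z hz ?_
  rw [← Int.abs_eq_natAbs]
  rcases abs_choice D with h | h <;> rw [h]
  · exact hmem
  · rw [neg_smul]; exact neg_mem hmem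

theorem PowerBasis.discr_eq_polyDisc {L : Type*} [Field L] [NumberField L]
    (B : PowerBasis ℚ L) (hB : IsIntegral ℤ B.gen) :
    Algebra.discr ℚ B.basis = polyDisc (minpoly ℤ B.gen) := by
  have hm := minpoly.monic hB
  have hdim : B.dim = (AdjoinRoot.powerBasis' hm).dim := by
    rw [AdjoinRoot.powerBasis'_dim, ← B.natDegree_minpoly,
      minpoly.isIntegrallyClosed_eq_field_fractions' ℚ hB, hm.natDegree_map]
  rw [polyDisc, dif_pos hm, ← Algebra.discr_reindex ℚ B.basis (finCongr hdim),
    ← Module.Basis.coe_reindex]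
  exact Algebra.discr_eq_intCast_discr (AdjoinRoot.powerBasis' hm).basis
    (B.basis.reindex (finCongr hdim))
    (AdjoinRoot.lift (algebraMap ℤ L) B.gen (minpoly.aeval ℤ B.gen))
    fun i => by simp [PowerBasis.basis_eq_pow]

theorem PowerBasis.norm_smul_gen_add {F L : Type*} [Field F] [Field L] [Algebra F L]
    (B : PowerBasis F L) {u : F} (hu : u ≠ 0) (v : F) :
    Algebra.norm F (algebraMap F L u * B.gen + algebraMap F L v) =
      (-u) ^ B.dim * (minpoly F B.gen).eval (-v / u) := by
  have hu' : algebraMap F L u ≠ 0 := by simpa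
  have : algebraMap F L u * B.gen + algebraMap F L v =
      algebraMap F L (-u) * (algebraMap F L (-v / u) - B.gen) := by
    simp only [map_neg, map_div₀]
    field_simp
    ring
  rw [this, map_mul, B.norm_algebraMap_sub_gen, Algebra.norm_algebraMap, B.finrank]

theorem PowerBasis.sq_discr_mul_sq_eq {L : Type*} [Field L] [NumberField L]
    (B : PowerBasis ℚ L) {k : ℕ} (hk : k ≠ 0) {c m : ℚ} (hm : m ≠ 0)
    (hmin : minpoly ℚ B.gen = X ^ (k + 2) + C c * (C m * X + 1) ^ 2) :
    Algebra.discr ℚ B.basis ^ 2 * c ^ 2 =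
      (c ^ (k + 2) * ((k + 2) ^ (k + 2) + 4 * c * (-m) ^ (k + 2) * k ^ k)) ^ 2 := by
  have hdim : B.dim = k + 2 := by
    rw [← B.natDegree_minpoly, hmin]
    compute_degree!
    simp [hk]
  have hk' : (k : ℚ) ≠ 0 := by exact_mod_cast hk
  have hroot := minpoly.aeval ℚ B.gen
  have hθ : Algebra.norm ℚ B.gen ^ 2 = c ^ 2 := by
    have := B.norm_smul_gen_add one_ne_zero 0
    simp only [map_one, map_zero, one_mul, add_zero, hmin] at this
    rw [this, mul_pow, ← pow_mul, mul_comm _ 2, pow_mul]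
    simp
  have h1 : Algebra.norm ℚ (algebraMap ℚ L m * B.gen + algebraMap ℚ L 1) = 1 := by
    rw [B.norm_smul_gen_add hm, hmin, hdim]
    simp only [eval_add, eval_mul, eval_pow, eval_C, eval_X, eval_one]
    rw [mul_div_cancel₀ _ hm]
    rw [neg_add_cancel, zero_pow two_ne_zero, mul_zero, add_zero, ← mul_pow]
    field_simp
    simp
  have h2 : Algebra.norm ℚ (algebraMap ℚ L (k * m) * B.gen + algebraMap ℚ L (k + 2)) =
      (k + 2) ^ (k + 2) + 4 * c * (-m) ^ (k + 2) * k ^ k := by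
    rw [B.norm_smul_gen_add (mul_ne_zero hk' hm), hmin, hdim]
    simp only [eval_add, eval_mul, eval_pow, eval_C, eval_X, eval_one]
    have e1 : m * (-(k + 2 : ℚ) / (k * m)) + 1 = -2 / k := by field_simp; ring
    have e2 : (-(k * m)) ^ (k + 2) = (-m) ^ (k + 2) * k ^ k * (k : ℚ) ^ 2 := by
      rw [mul_assoc, ← pow_add, ← mul_pow]; ring
    rw [e1, mul_add, ← mul_pow]
    congr 1
    · congr 1; field_simp
    · rw [e2]; field_simp; ring
  have hder : B.gen * aeval B.gen (derivative (minpoly ℚ B.gen)) =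
      algebraMap ℚ L (-c) * (algebraMap ℚ L m * B.gen + algebraMap ℚ L 1) *
        (algebraMap ℚ L (k * m) * B.gen + algebraMap ℚ L (k + 2)) := by
    rw [hmin] at hroot ⊢
    simp [derivative_pow] at hroot ⊢
    linear_combination (k + 2 : L) * hroot
  rw [Algebra.discr_powerBasis_eq_norm, mul_pow, ← pow_mul, mul_comm _ 2, pow_mul, neg_one_sq,
    one_pow, one_mul, ← hθ, ← mul_pow, mul_comm (Algebra.norm ℚ _), ← map_mul, hder, map_mul,
    map_mul, h1, h2, Algebra.norm_algebraMap, B.finrank, hdim, mul_one, mul_pow, mul_pow,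
    ← pow_mul, ← pow_mul, mul_comm _ 2, pow_mul, pow_mul, neg_sq]

theorem Int.exists_double_root_mod_sq {p c m : ℤ} {k : ℕ} (hk : k ≠ 0) (hp : Prime p)
    (hp2 : ¬ p ∣ 2) (hpc : ¬ p ∣ c) (hpm : ¬ p ∣ m)
    (hE : p ^ 2 ∣ ((k : ℤ) + 2) ^ (k + 2) + 4 * c * (-m) ^ (k + 2) * (k : ℤ) ^ k) :
    ∃ r : ℤ, p ^ 2 ∣ r ^ (k + 2) + c * (m * r + 1) ^ 2 ∧
      p ^ 2 ∣ (k + 2) * r ^ (k + 1) + 2 * c * m * (m * r + 1) := by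
  have hpE := (dvd_pow_self p two_ne_zero).trans hE
  have hpm' : ¬ p ∣ (-m) ^ (k + 2) := fun h => hpm (by simpa using hp.dvd_of_dvd_pow h)
  have hp4 : ¬ p ∣ 4 := fun h => hp2 (hp.dvd_of_dvd_pow (show p ∣ 2 ^ 2 by simpa using h))
  have hpk : ¬ p ∣ (k : ℤ) := by
    intro h
    have h1 : p ∣ ((k : ℤ) + 2) ^ (k + 2) :=
      (Int.dvd_add_left (Dvd.dvd.mul_left (dvd_pow h hk) _)).mp hpE
    exact hp2 ((Int.dvd_add_right h).mp (hp.dvd_of_dvd_pow h1))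
  have hpn : ¬ p ∣ (k : ℤ) + 2 := by
    intro h
    have h1 := (Int.dvd_add_right (dvd_pow h (by omega))).mp hpE
    rcases hp.dvd_or_dvd h1 with h1 | h1
    · rcases hp.dvd_or_dvd h1 with h1 | h1
      · exact (hp.dvd_or_dvd h1).elim hp4 hpc
      · exact hpm' h1
    · exact hpk (hp.dvd_of_dvd_pow h1)
  have hpkm : ¬ p ∣ k * m := fun h => (hp.dvd_or_dvd h).elim hpk hpm
  obtain ⟨s, t, hst⟩ : IsCoprime (k * m) (p ^ 2) :=
    (IsCoprime.pow_left ((hp.coprime_iff_not_dvd).mpr hpkm)).symm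
  have hr : p ^ 2 ∣ k * m * (-(k + 2) * s) + (k + 2) := ⟨(k + 2) * t, by
    linear_combination -((k : ℤ) + 2) * hst⟩
  generalize -((k : ℤ) + 2) * s = r at hr
  have h1 : p ^ 2 ∣ r ^ (k + 2) + c * (m * r + 1) ^ 2 := by
    refine (IsCoprime.pow ((hp.coprime_iff_not_dvd).mpr hpkm) :
      IsCoprime (p ^ 2) ((k * m) ^ (k + 2))).dvd_of_dvd_mul_left ?_
    have ek : (k * m * r : ℤ) ≡ -(k + 2) [ZMOD p ^ 2] :=
      (Int.modEq_iff_dvd.mpr (by rwa [sub_neg_eq_add])).symm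
    have e1 := ek.pow (k + 2)
    have e2 : (k * (m * r + 1) : ℤ) ≡ -2 [ZMOD p ^ 2] := by
      have := ek.add_right (k : ℤ)
      ring_nf at this ⊢
      exact this
    have e3 := e1.add (((e2.pow 2).mul_left (c * (m ^ (k + 2) * k ^ k))))
    have e4 : (k * m : ℤ) ^ (k + 2) * (r ^ (k + 2) + c * (m * r + 1) ^ 2) =
        (k * m * r) ^ (k + 2) + c * (m ^ (k + 2) * k ^ k) * (k * (m * r + 1)) ^ 2 := by ring
    rw [e4]
    refine e3.dvd_iff.mpr ?_
    have e5 := hE.mul_left ((-1) ^ (k + 2))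
    have e6 : ((-1) ^ (k + 2)) ^ 2 = (1 : ℤ) := by
      rw [← pow_mul, mul_comm, pow_mul]; simp
    refine e5.trans (dvd_of_eq ?_)
    rw [neg_pow ((k : ℤ) + 2), neg_pow m]
    linear_combination (4 * c * m ^ (k + 2) * (k : ℤ) ^ k) * e6
  refine ⟨r, h1, ?_⟩
  have hpr : ¬ p ∣ r := fun h => hpn <|
    (Int.dvd_add_right (h.mul_left _)).mp ((dvd_pow_self p two_ne_zero).trans hr)
  refine (IsCoprime.pow_left ((hp.coprime_iff_not_dvd).mpr hpr)).dvd_of_dvd_mul_left (?_ :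
    p ^ 2 ∣ r * ((k + 2) * r ^ (k + 1) + 2 * c * m * (m * r + 1)))
  have : r * ((k + 2) * r ^ (k + 1) + 2 * c * m * (m * r + 1)) =
      (k + 2) * (r ^ (k + 2) + c * (m * r + 1) ^ 2) -
        c * (m * r + 1) * (k * m * r + (k + 2)) := by ring
  rw [this]
  exact dvd_sub (h1.mul_left _) (hr.mul_left _)

theorem adjoin_ne_top_of_double_root_mod_sq {K : Type*} [Field K] [NumberField K] (θ : 𝓞 K)
    {p r : ℤ} (hp : Prime p) (h0 : p ^ 2 ∣ (minpoly ℤ θ).eval r)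
    (h1 : p ^ 2 ∣ (derivative (minpoly ℤ θ)).eval r) : Algebra.adjoin ℤ {θ} ≠ ⊤ := by
  intro htop
  set f := minpoly ℤ θ with hf
  have hint : IsIntegral ℤ θ := RingOfIntegers.isIntegral θ
  have hfm : f.Monic := minpoly.monic hint
  have hdeg : 0 < f.natDegree := minpoly.natDegree_pos hint
  set g := f /ₘ (X - C r)
  have hfg : f = C (f.eval r) + (X - C r) * g := by
    have := modByMonic_add_div f (X - C r)
    rw [modByMonic_X_sub_C_eq_C_eval] at this
    exact this.symm
  set h := g /ₘ (X - C r)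
  have hgh : g = C (g.eval r) + (X - C r) * h := by
    have := modByMonic_add_div g (X - C r)
    rw [modByMonic_X_sub_C_eq_C_eval] at this
    exact this.symm
  have hgr : g.eval r = (derivative f).eval r := by
    conv_rhs => rw [hfg]
    simp
  rw [← hgr] at h1
  obtain ⟨A, hA⟩ := h0
  obtain ⟨B, hB⟩ := h1
  have hroot : aeval θ f = 0 := minpoly.aeval ℤ θ
  have hsq : (p : 𝓞 K) ^ 2 ∣ (aeval θ g) ^ 2 := by
    have ef := congrArg (aeval θ) hfg
    have eg := congrArg (aeval θ) hgh
    rw [hroot, hA] at ef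
    rw [hB] at eg
    simp at ef eg
    refine ⟨B * aeval θ g - A * aeval θ h, ?_⟩
    linear_combination (aeval θ g) * eg - (aeval θ h) * ef
  obtain ⟨z, hz⟩ := (IsIntegrallyClosed.pow_dvd_pow_iff two_ne_zero).mp hsq
  have hzmem : z ∈ Algebra.adjoin ℤ {θ} := htop ▸ Algebra.mem_top
  rw [Algebra.adjoin_singleton_eq_range_aeval] at hzmem
  obtain ⟨q, rfl⟩ := hzmem
  have hdvd : f ∣ g - C p * q :=
    minpoly.isIntegrallyClosed_dvd hint (by simpa [sub_eq_zero] using hz)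
  have hgm : g.Monic := by
    rw [Monic, leadingCoeff_divByMonic_X_sub_C f
      (natDegree_pos_iff_degree_pos.mp hdeg).ne', hfm]
  have hgd : g.natDegree = f.natDegree - 1 := by
    rw [natDegree_divByMonic _ (monic_X_sub_C r), natDegree_X_sub_C]
  have : Fact p.natAbs.Prime := ⟨Int.prime_iff_natAbs_prime.mp hp⟩
  have hp0 : Int.castRingHom (ZMod p.natAbs) p = 0 := by
    rw [eq_intCast, ZMod.intCast_zmod_eq_zero_iff_dvd]; simp
  have := Polynomial.map_dvd (Int.castRingHom (ZMod p.natAbs)) hdvd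
  simp only [Polynomial.map_sub, Polynomial.map_mul, map_C, hp0, C_0, zero_mul,
    sub_zero] at this
  have := natDegree_le_of_dvd this (hgm.map _).ne_zero
  rw [hfm.natDegree_map, hgm.natDegree_map] at this
  omega

theorem Int.exists_eq_mul_sq_of_sq_eq {a b c : ℤ} (habc : b ^ 2 = 4 * a * c)
    (hc : Squarefree c) (h2 : 2 ∣ c) : ∃ m : ℤ, a = c * m ^ 2 ∧ b = 2 * c * m := by
  have hc0 : c ≠ 0 := hc.ne_zero
  obtain ⟨l, rfl⟩ : c ∣ b :=
    (hc.dvd_pow_iff_dvd two_ne_zero).mp (habc ▸ Dvd.intro_left _ rfl)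
  have h1 : c * l ^ 2 = 4 * a := mul_left_cancel₀ hc0 (by linear_combination habc)
  obtain ⟨d, rfl⟩ := h2
  have hd : ¬ 2 ∣ d := fun ⟨e, he⟩ => by
    have := hc 2 ⟨e, by rw [he]; ring⟩
    norm_num [Int.isUnit_iff] at this
  have h2 : 2 ∣ l ^ 2 := by
    refine (Int.prime_two.dvd_or_dvd (⟨a, ?_⟩ : 2 ∣ d * l ^ 2)).resolve_left hd
    linarith
  obtain ⟨m, rfl⟩ := Int.prime_two.dvd_of_dvd_pow h2
  exact ⟨m, by linarith, by ring⟩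

theorem isEisensteinAt_X_pow_add_mul_sq {k : ℕ} {c m p : ℤ} (hp : Prime p) (hc : Squarefree c)
    (hk : k ≠ 0) (hpc : p ∣ c) :
    (X ^ (k + 2) + C c * (C m * X + 1) ^ 2).IsEisensteinAt (Ideal.span {p}) := by
  have hdeg : (X ^ (k + 2) + C c * (C m * X + 1) ^ 2).natDegree = k + 2 := by
    compute_degree!
    simp [hk]
  have hm : (X ^ (k + 2) + C c * (C m * X + 1) ^ 2).Monic := by
    monicity!
    simp [hk]
  refine ⟨?_, fun {i} hi => ?_, ?_⟩
  · rw [hm.leadingCoeff, Ideal.mem_span_singleton]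
    exact fun h => hp.not_isUnit (isUnit_of_dvd_one h)
  · rw [hdeg] at hi
    rw [Ideal.mem_span_singleton, coeff_add, coeff_X_pow, if_neg hi.ne, zero_add, coeff_C_mul]
    exact hpc.mul_right _
  · rw [Ideal.span_singleton_pow, Ideal.mem_span_singleton]
    intro h
    have h0 : (X ^ (k + 2) + C c * (C m * X + 1) ^ 2).coeff 0 = c := by
      simp [coeff_zero_eq_eval_zero]
    rw [h0] at h
    exact hp.not_isUnit (hc p (by rwa [← sq]))

theorem minpoly_eq_of_irreducible_of_monic_s6 {S : Type*} [CommRing S] [IsDomain S] [CharZero S]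
    {f : ℤ[X]} (hf : Irreducible f) (hm : f.Monic) {x : S} (hx : aeval x f = 0) :
    minpoly ℤ x = f := by
  have hint : IsIntegral ℤ x := ⟨f, hm, hx⟩
  exact eq_of_monic_of_associated (minpoly.monic hint) hm
    ((minpoly.irreducible hint).associated_of_dvd hf (minpoly.isIntegrallyClosed_dvd hint hx))

theorem algebraMap_mem_adjoin_iff {K : Type*} [Field K] (θ z : 𝓞 K) :
    (z : K) ∈ Algebra.adjoin ℤ {(θ : K)} ↔ z ∈ Algebra.adjoin ℤ {θ} := by
  have := (Algebra.ofId (𝓞 K) K).restrictScalars ℤ |>.map_adjoin_singleton θ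
  change _ = Algebra.adjoin ℤ {(θ : K)} at this
  rw [← this, Subalgebra.mem_map]
  refine ⟨?_, fun h => ⟨z, h, rfl⟩⟩
  rintro ⟨w, hw, hwz⟩
  rwa [← RingOfIntegers.ext (x := w) (y := z) hwz]

theorem stmt_6 (n : ℕ) (hn : 3 ≤ n) (a b c : ℤ) (habc : b ^ 2 = 4 * a * c)
    (hc1 : c ≠ 1) (hc1' : c ≠ -1) (hcsf : Squarefree c)
    (hsameprimes : ∀ p : ℕ, p.Prime →
      (((p : ℤ) ∣ a ↔ (p : ℤ) ∣ b) ∧ ((p : ℤ) ∣ b ↔ (p : ℤ) ∣ c)))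
    (hcong : (2 : ℤ) ∣ c ∨ a ≡ 1 [ZMOD 4] ∨ c ≡ 1 [ZMOD 4])
    (f : Polynomial ℤ) (hf : f = X ^ n + C a * X ^ 2 + C b * X + C c)
    (hirr : Irreducible f)
    (K : Type*) [Field K] [NumberField K] (θ : 𝓞 K)
    (hroot : Polynomial.aeval (θ : K) f = 0)
    (hgen : Algebra.adjoin ℚ {(θ : K)} = ⊤) :
    Algebra.adjoin ℤ {θ} = ⊤ ↔
      ∀ p : ℕ, p.Prime → (p : ℤ) ∣ polyDisc f → ¬ (p : ℤ) ∣ a →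
        ¬ (p : ℤ) ^ 2 ∣ polyDisc f := by
  have h2c : (2 : ℤ) ∣ c := by
    refine (hsameprimes 2 Nat.prime_two).2.mp (Int.prime_two.dvd_of_dvd_pow (n := 2) ?_)
    exact ⟨2 * a * c, by rw [habc]; ring⟩
  obtain ⟨m, rfl, rfl⟩ := Int.exists_eq_mul_sq_of_sq_eq habc hcsf h2c
  obtain ⟨k, rfl⟩ : ∃ k, n = k + 2 := ⟨n - 2, by omega⟩
  have hk : k ≠ 0 := by omega
  replace hf : f = X ^ (k + 2) + C c * (C m * X + 1) ^ 2 := by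
    rw [hf]
    simp only [map_mul, map_pow, map_ofNat]
    ring
  have hm : f.Monic := by
    rw [hf]
    monicity!
    simp [hk]
  have hmin : minpoly ℤ (θ : K) = f := minpoly_eq_of_irreducible_of_monic_s6 hirr hm hroot
  have hint : IsIntegral ℤ (θ : K) := θ.isIntegral_coe
  obtain ⟨B, hBθ⟩ : ∃ B : PowerBasis ℚ K, B.gen = θ :=
    ⟨PowerBasis.ofAdjoinEqTop (hint.tower_top) hgen, rfl⟩
  have hBint : IsIntegral ℤ B.gen := hBθ ▸ hint
  have hD : Algebra.discr ℚ B.basis = polyDisc f := by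
    rw [B.discr_eq_polyDisc hBint, hBθ, hmin]
  constructor
  · intro htop p hp _ hpa hpD
    have hp' : Prime (p : ℤ) := Nat.prime_iff_prime_int.mp hp
    have hpc : ¬ (p : ℤ) ∣ c := fun h => hpa (h.mul_right _)
    have hpm : ¬ (p : ℤ) ∣ m := fun h => hpa ((dvd_pow h two_ne_zero).mul_left _)
    have hm0 : m ≠ 0 := by rintro rfl; simp at hpm
    have hdisc := B.sq_discr_mul_sq_eq hk (c := c) (m := m) (by exact_mod_cast hm0) (by
      rw [minpoly.isIntegrallyClosed_eq_field_fractions' ℚ hBint, hBθ, hmin, hf]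
      simp)
    rw [hD] at hdisc
    have hdisc' : polyDisc f ^ 2 * c ^ 2 = (c ^ (k + 2) *
        (((k : ℤ) + 2) ^ (k + 2) + 4 * c * (-m) ^ (k + 2) * (k : ℤ) ^ k)) ^ 2 := by
      exact_mod_cast hdisc
    have hE := (Int.pow_dvd_pow_iff two_ne_zero).mp
      (hdisc' ▸ (pow_dvd_pow_of_dvd hpD 2).mul_right (c ^ 2))
    have hE := (IsCoprime.pow ((hp'.coprime_iff_not_dvd).mpr hpc)).dvd_of_dvd_mul_left hE
    obtain ⟨r, hr0, hr1⟩ :=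
      Int.exists_double_root_mod_sq hk hp' (fun h => hpc (h.trans h2c)) hpc hpm hE
    have hmin' : minpoly ℤ θ = f := by rw [← RingOfIntegers.minpoly_coe, hmin]
    refine adjoin_ne_top_of_double_root_mod_sq θ hp' (r := r) ?_ ?_ htop
    · rw [hmin', hf]
      simpa using hr0
    · rw [hmin', hf]
      convert hr1 using 1
      simp [derivative_pow]
      ring
  · intro h
    have hmem : ∀ z : K, IsIntegral ℤ z → z ∈ Algebra.adjoin ℤ {B.gen} := fun z hz => by
      refine B.mem_adjoin_of_forall_prime hBint (fun p hp z hz hpz => ?_) hD hz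
      have hp' : Prime (p : ℤ) := Nat.prime_iff_prime_int.mp hp
      by_cases hpa : (p : ℤ) ∣ c * m ^ 2
      · have hpc := (hsameprimes p hp).2.mp ((hsameprimes p hp).1.mp hpa)
        refine mem_adjoin_of_smul_prime_smul_of_minpoly_isEisensteinAt hp' hBint hz hpz ?_
        rw [hBθ, hmin, hf]
        exact isEisensteinAt_X_pow_add_mul_sq hp' hcsf hk hpc
      · by_contra hz'
        have hsq := B.sq_dvd_discr_of_smul_mem_adjoin hBint hD hp' hz hpz hz'
        exact h p hp ((dvd_pow_self _ two_ne_zero).trans hsq) hpa hsq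
    rw [hBθ] at hmem
    exact Algebra.eq_top_iff.mpr fun z =>
      (algebraMap_mem_adjoin_iff θ z).mp (hmem z z.isIntegral_coe)
end

section
/- Let f(x) = x^n + a·x^2 + b·x + c ∈ ℤ[x] be a polynomial of degree n ≥ 3 with b^2 = 4·a·c and a ≠ 0, and let p be a prime not dividing b·(n−2). Then D_f ≡ 0 (mod p^2) if and only if f(−n·b/(2·a·(n−2))) ≡ 0 (mod p^2), where the congruence for the rational number f(−nb/(2a(n−2))) means its numerator is divisible by p^2 after clearing the (p-coprime) denominator. -/
open Polynomial NumberField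

/-- The determinant of `h(M)` is the product of `h` over the eigenvalues of `M`. -/
theorem Matrix.det_aeval_of_charpoly_eq_prod {K ι κ : Type*} [Field K] [IsAlgClosed K] [Fintype ι]
    [DecidableEq ι] [Fintype κ] (M : Matrix ι ι K) (α : κ → K)
    (hM : M.charpoly = ∏ k, (X - C (α k))) (h : K[X]) :
    (aeval M h).det = ∏ k, h.eval (α k) := by
  have hcard : Fintype.card ι = Fintype.card κ := by
    have := M.charpoly_natDegree_eq_dim
    rw [hM, natDegree_prod_of_monic _ _ fun k _ => monic_X_sub_C _] at this
    simpa using this.symm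
  induction IsAlgClosed.splits h using Submonoid.closure_induction with
  | mem p hp =>
    rcases hp with ⟨r, rfl⟩ | ⟨r, rfl⟩
    · simp [Matrix.algebraMap_eq_diagonal, Pi.algebraMap_def, hcard]
    · have h1 := Matrix.eval_charpoly M (-r)
      rw [hM, eval_prod] at h1
      have h2 : aeval M (X + C r) = -(Matrix.scalar ι (-r) - M) := by
        simp [Matrix.algebraMap_eq_diagonal, Pi.algebraMap_def, Matrix.scalar_apply]
        rw [← Matrix.diagonal_neg]; abel_nf
      rw [h2, Matrix.det_neg, ← h1, hcard, ← Finset.card_univ, ← Finset.prod_const,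
        ← Finset.prod_mul_distrib]
      refine Finset.prod_congr rfl fun k _ => ?_
      simp
  | one => simp
  | mul p q _ _ hp hq => simp [hp, hq, Finset.prod_mul_distrib]

/-- The trace of `h(M)` is the sum of `h` over the eigenvalues of `M`. -/
theorem Matrix.trace_aeval_of_charpoly_eq_prod {K ι κ : Type*} [Field K] [IsAlgClosed K] [Fintype ι]
    [DecidableEq ι] [Fintype κ] (M : Matrix ι ι K) (α : κ → K)
    (hM : M.charpoly = ∏ k, (X - C (α k))) (h : K[X]) :
    (aeval M h).trace = ∑ k, h.eval (α k) := by
  have hchar : (aeval M h).charpoly = ∏ k, (X - C (h.eval (α k))) := by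
    refine Polynomial.funext fun t => ?_
    have := M.det_aeval_of_charpoly_eq_prod α hM (C t - h)
    rw [Matrix.eval_charpoly, eval_prod]
    simpa [Matrix.algebraMap_eq_diagonal, Pi.algebraMap_def, Matrix.scalar_apply] using this
  rw [Matrix.trace_eq_sum_roots_charpoly, hchar, roots_prod _ _ (Finset.prod_ne_zero_iff.2 fun k _ => X_sub_C_ne_zero _)]
  simp [roots_X_sub_C]

/-- The squared Vandermonde determinant is, up to sign, the product of the values at the `α i` of
the derivative of `∏ k, (X - C (α k))`. -/
theorem Matrix.det_vandermonde_sq_eq_prod_derivative {R : Type*} [CommRing R] {n : ℕ}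
    (α : Fin n → R) : ∃ ε : ℤ, (ε = 1 ∨ ε = -1) ∧ (Matrix.vandermonde α).det ^ 2 =
      ε * ∏ i, (derivative (∏ k, (X - C (α k)))).eval (α i) := by
  have hder (i : Fin n) : (derivative (∏ k, (X - C (α k)))).eval (α i) =
      ∏ j ∈ {i}ᶜ, (α i - α j) := by
    rw [derivative_prod_finset, eval_finsetSum, Finset.sum_eq_single i]
    · simp [eval_prod, Finset.compl_singleton]
    · intro j _ hj
      rw [eval_mul, eval_prod, Finset.prod_eq_zero (i := i)] <;> simp [hj.symm]
    · simp
  simp_rw [hder]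
  rw [← Finset.prod_prod_Ioi_mul_eq_prod_prod_off_diag fun j i => α i - α j,
    Matrix.det_vandermonde, ← Finset.prod_pow]
  refine ⟨∏ i : Fin n, ∏ j ∈ Finset.Ioi i, -1, ?_, ?_⟩
  · simp only [Finset.prod_const]
    rw [Finset.prod_pow_eq_pow_sum]
    exact neg_one_pow_eq_or ℤ _
  · push_cast
    rw [← Finset.prod_mul_distrib]
    refine Finset.prod_congr rfl fun i _ => ?_
    rw [← Finset.prod_mul_distrib, ← Finset.prod_pow]
    refine Finset.prod_congr rfl fun j _ => ?_
    ring

theorem AdjoinRoot.charpoly_leftMulMatrix_powerBasis' {R : Type*} [CommRing R] {f : R[X]}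
    (hf : f.Monic) :
    (Algebra.leftMulMatrix (AdjoinRoot.powerBasis' hf).basis (AdjoinRoot.root f)).charpoly = f := by
  nontriviality R
  set M := Algebra.leftMulMatrix (AdjoinRoot.powerBasis' hf).basis (AdjoinRoot.root f) with hM
  have hdvd : f ∣ M.charpoly := by
    rw [← AdjoinRoot.mk_eq_zero, ← AdjoinRoot.aeval_eq]
    apply Algebra.leftMulMatrix_injective (AdjoinRoot.powerBasis' hf).basis
    rw [← aeval_algHom_apply, ← hM, Matrix.aeval_self_charpoly, map_zero]
  refine eq_of_monic_of_dvd_of_natDegree_le hf M.charpoly_monic hdvd ?_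
  rw [Matrix.charpoly_natDegree_eq_dim, Fintype.card_fin, AdjoinRoot.powerBasis'_dim]

/-- The discriminant of a power basis is the squared Vandermonde determinant of the roots of the
characteristic polynomial of its generator. -/
theorem PowerBasis.map_discr {R S K : Type*} [CommRing R] [CommRing S] [Algebra R S] [Field K]
    [IsAlgClosed K] (φ : R →+* K) (pb : PowerBasis R S) (α : Fin pb.dim → K)
    (hα : (Algebra.leftMulMatrix pb.basis pb.gen).charpoly.map φ = ∏ k, (X - C (α k))) :
    φ (Algebra.discr R pb.basis) = (Matrix.vandermonde α).det ^ 2 := by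
  rw [Algebra.discr_def, RingHom.map_det, RingHom.mapMatrix_apply]
  have : (Algebra.traceMatrix R pb.basis).map φ =
      (Matrix.vandermonde α).transpose * Matrix.vandermonde α := by
    ext i j
    rw [Matrix.vandermonde_transpose_mul_vandermonde, Matrix.map_apply, Algebra.traceMatrix_apply,
      Algebra.traceForm_apply, PowerBasis.basis_eq_pow, PowerBasis.basis_eq_pow, ← pow_add,
      Algebra.trace_eq_matrix_trace pb.basis, map_pow, AddMonoidHom.map_trace φ, Matrix.map_pow]
    have h := Matrix.trace_aeval_of_charpoly_eq_prod
      ((Algebra.leftMulMatrix pb.basis pb.gen).map φ) α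
      (by rw [Matrix.charpoly_map, hα]) (X ^ (i + j : ℕ))
    simpa using h
  rw [this, Matrix.det_mul, Matrix.det_transpose, sq]

theorem Polynomial.Monic.exists_eq_prod_X_sub_C {K : Type*} [Field K] [IsAlgClosed K] {g : K[X]}
    (hg : g.Monic) {n : ℕ} (hn : g.natDegree = n) :
    ∃ α : Fin n → K, g = ∏ k, (X - C (α k)) := by
  obtain rfl : g.roots.toList.length = n := by
    rw [Multiset.length_toList, ← hn, ← (IsAlgClosed.splits g).natDegree_eq_card_roots]
  refine ⟨g.roots.toList.get, ?_⟩
  conv_lhs => rw [(IsAlgClosed.splits g).eq_prod_roots_of_monic hg]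
  generalize g.roots = s
  rw [← List.prod_ofFn]
  conv_lhs => rw [← Multiset.coe_toList s, Multiset.map_coe, Multiset.prod_coe]
  congr 1
  simp [List.ext_get_iff]

/-- For `f = X ^ n + a X ^ 2 + b X + c` with `b ^ 2 = 4 a c`, the identity
`4 a x f.derivative(x) = -(2 a x + b) (2 a (n - 2) x + n b)` at the roots of `f` relates the discriminant
of `f` to the value of `f` at `-n b / (2 a (n - 2))`, up to sign. -/
theorem polyDisc_mul_eq {n : ℕ} (hn : 3 ≤ n) {a b c : ℤ} (habc : b ^ 2 = 4 * a * c) (ha : a ≠ 0)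
    {f : ℤ[X]} (hf : f = X ^ n + C a * X ^ 2 + C b * X + C c) {N : ℤ}
    (hN : (N : ℚ) = (2 * (a : ℚ) * ((n : ℚ) - 2)) ^ n *
      Polynomial.aeval (-((n : ℚ) * (b : ℚ)) / (2 * (a : ℚ) * ((n : ℚ) - 2))) f) :
    ∃ ε : ℤ, (ε = 1 ∨ ε = -1) ∧ (4 * a) ^ n * c * polyDisc f = ε * (b ^ n * N) := by
  have hdeg : (C a * X ^ 2 + C b * X + C c).degree < (n : WithBot ℕ) :=
    degree_quadratic_le.trans_lt (by exact_mod_cast hn)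
  have hf' : f = X ^ n + (C a * X ^ 2 + C b * X + C c) := by rw [hf]; ring
  have hmonic : f.Monic := hf' ▸ monic_X_pow_add hdeg
  have hnat : f.natDegree = n := by
    rw [hf', natDegree_add_eq_left_of_degree_lt (by rwa [degree_X_pow]), natDegree_X_pow]
  set pb := AdjoinRoot.powerBasis' hmonic
  have hdim : pb.dim = n := hnat
  have hchar : (Algebra.leftMulMatrix pb.basis pb.gen).charpoly = f :=
    AdjoinRoot.charpoly_leftMulMatrix_powerBasis' hmonic
  set φ := Int.castRingHom ℂ
  obtain ⟨α, hα⟩ := (hmonic.map φ).exists_eq_prod_X_sub_C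
    (show (f.map φ).natDegree = pb.dim by rw [hmonic.natDegree_map, hnat, hdim])
  have hdisc := pb.map_discr φ α (by rw [hchar, hα])
  obtain ⟨ε, hε, hV⟩ := Matrix.det_vandermonde_sq_eq_prod_derivative α
  have hprod (y : ℂ) : ∏ k, (y - α k) = y ^ n + a * y ^ 2 + b * y + c := by
    have := congrArg (eval y) hα
    rw [eval_prod] at this
    simpa [hf, φ] using this.symm
  have hroot (k) : α k ^ n + a * α k ^ 2 + b * α k + c = 0 := by
    rw [← hprod, Finset.prod_eq_zero (Finset.mem_univ k) (sub_self _)]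
  have habc' : (b : ℂ) ^ 2 = 4 * a * c := by exact_mod_cast habc
  have ha' : (a : ℂ) ≠ 0 := by exact_mod_cast ha
  have hn' : (n : ℂ) - 2 ≠ 0 := by
    rw [sub_ne_zero]; exact_mod_cast (by omega : n ≠ 2)
  have hder (k) : 4 * a * (α k * (derivative (∏ k, (X - C (α k)))).eval (α k)) =
      (2 * a * (-b / (2 * a) - α k)) *
        (2 * a * (n - 2) * (-(n * b) / (2 * a * (n - 2)) - α k)) * -1 := by
    rw [← hα, hf]
    have hpow : α k * α k ^ (n - 1) = α k ^ n := mul_pow_sub_one (by omega) _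
    have h1 : 2 * a * (-b / (2 * a) - α k) = -(2 * a * α k + b) := by field_simp; ring
    have h2 : 2 * a * (n - 2) * (-(n * b) / (2 * a * (n - 2)) - α k) =
        -(2 * a * (n - 2) * α k + n * b) := by field_simp; ring
    rw [h1, h2]
    simp [φ, derivative_X_pow]
    linear_combination 4 * a * n * hpow + 4 * a * n * hroot k + n * habc'
  have hall := Finset.prod_congr (rfl : (Finset.univ : Finset (Fin pb.dim)) = _) fun k _ => hder k
  simp only [Finset.prod_mul_distrib, Finset.prod_const, hprod, Finset.card_univ,
    Fintype.card_fin, hdim] at hall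
  have hα0 : ∏ k, α k = (-1) ^ n * c := by
    have := hprod 0
    simp only [zero_sub, Finset.prod_neg, Finset.card_univ, Fintype.card_fin, hdim] at this
    have h0 : (0 : ℂ) ^ n = 0 := zero_pow (by omega)
    rw [h0] at this
    have hs : ((-1 : ℂ) ^ n) * (-1) ^ n = 1 := by rw [← mul_pow]; simp
    linear_combination (-1) ^ n * this - (∏ k, α k) * hs
  have hb : (2 * (a : ℂ)) ^ n * ((-b / (2 * a)) ^ n + a * (-b / (2 * a)) ^ 2 +
      b * (-b / (2 * a)) + c) = (-1) ^ n * b ^ n := by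
    have h0 : a * (-b / (2 * a)) ^ 2 + b * (-b / (2 * a)) + c = (0 : ℂ) := by
      field_simp; linear_combination -habc'
    rw [add_assoc, add_assoc, ← add_assoc (_ * _ ^ 2), h0, add_zero, ← mul_pow, ← mul_pow]
    congr 1; field_simp
  have hNC : (N : ℂ) = (2 * a * (n - 2)) ^ n * ((-(n * b) / (2 * a * (n - 2))) ^ n +
      a * (-(n * b) / (2 * a * (n - 2))) ^ 2 + b * (-(n * b) / (2 * a * (n - 2))) + c) := by
    have := congrArg (Rat.cast : ℚ → ℂ) hN
    simpa [hf] using this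
  have hfin : (4 * a : ℂ) ^ n * c * (Algebra.discr ℤ pb.basis : ℤ) = ε * (-1) ^ n * (b ^ n * N) := by
    have hs : ((-1 : ℂ) ^ n) * (-1) ^ n = 1 := by rw [← mul_pow]; simp
    simp only [mul_pow] at hb hNC
    rw [hb, ← hNC, hα0] at hall
    have hD : ((Algebra.discr ℤ pb.basis : ℤ) : ℂ) = _ := hdisc.trans hV
    rw [hD]
    generalize ∏ i, eval (α i) (derivative (∏ k, (X - C (α k)))) = F at hall ⊢
    linear_combination ε * (-1) ^ n * hall +
      (ε * (-1) ^ n * b ^ n * N - ε * (4 * a) ^ n * c * F) * hs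
  refine ⟨ε * (-1) ^ n, ?_, ?_⟩
  · rcases hε with rfl | rfl <;> rcases neg_one_pow_eq_or ℤ n with h | h <;> simp [h]
  · rw [polyDisc, dif_pos hmonic]
    exact_mod_cast hfin

theorem stmt_10 (n : ℕ) (hn : 3 ≤ n) (a b c : ℤ) (habc : b ^ 2 = 4 * a * c) (ha : a ≠ 0)
    (f : Polynomial ℤ) (hf : f = X ^ n + C a * X ^ 2 + C b * X + C c)
    (p : ℕ) (hp : p.Prime) (hpb : ¬ (p : ℤ) ∣ b * ((n : ℤ) - 2))
    (N : ℤ)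
    (hN : (N : ℚ) = (2 * (a : ℚ) * ((n : ℚ) - 2)) ^ n *
      Polynomial.aeval (-((n : ℚ) * (b : ℚ)) / (2 * (a : ℚ) * ((n : ℚ) - 2))) f) :
    (p : ℤ) ^ 2 ∣ polyDisc f ↔ (p : ℤ) ^ 2 ∣ N := by
  obtain ⟨ε, hε, h⟩ := polyDisc_mul_eq hn habc ha hf hN
  have hp' : Prime (p : ℤ) := Nat.prime_iff_prime_int.mp hp
  have hb : ¬ (p : ℤ) ∣ b := fun hd => hpb (hd.mul_right _)
  have hcop {z : ℤ} (hz : z ∣ b ^ 2) : IsCoprime ((p : ℤ) ^ 2) z := by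
    refine IsCoprime.pow_left ((hp'.irreducible.coprime_iff_not_dvd).2 fun hd => hb ?_)
    exact hp'.dvd_of_dvd_pow (hd.trans hz)
  have hleft : IsCoprime ((p : ℤ) ^ 2) ((4 * a) ^ n * c) :=
    (hcop ⟨c, habc⟩).pow_right.mul_right (hcop ⟨4 * a, by rw [habc]; ring⟩)
  have hright : IsCoprime ((p : ℤ) ^ 2) (b ^ n) := (hcop ⟨b, sq b⟩).pow_right
  calc (p : ℤ) ^ 2 ∣ polyDisc f ↔ (p : ℤ) ^ 2 ∣ (4 * a) ^ n * c * polyDisc f :=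
        ⟨fun hd => hd.mul_left _, hleft.dvd_of_dvd_mul_left⟩
    _ ↔ (p : ℤ) ^ 2 ∣ b ^ n * N := by rw [h]; rcases hε with rfl | rfl <;> simp
    _ ↔ (p : ℤ) ^ 2 ∣ N := ⟨hright.dvd_of_dvd_mul_left, fun hd => hd.mul_left _⟩
end

section
/- Let a, b, c, n be integers with 2 ∤ a·c, 2 | b, 4 ∤ b, and let n > 2 be even. Let F(x) = ((a+a^2)/2)·x^2 + (a·c + b/2)·x + (c+c^2)/2 ∈ ℤ[x]. Then F(x) is coprime to x^{n/2} + a·x + c modulo 2 (i.e., their images in 𝔽₂[x] are coprime) if and only if a ≡ 1 (mod 4) or c ≡ 1 (mod 4). -/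
open Polynomial NumberField

theorem isCoprime_X_sub_C_of_eval_ne_zero {K : Type*} [Field K] {r : K} {q : Polynomial K}
    (h : q.eval r ≠ 0) : IsCoprime (X - C r) q :=
  ((irreducible_X_sub_C r).coprime_iff_not_dvd).2 fun hd => h (dvd_iff_isRoot.1 hd)

theorem not_isUnit_X_pow_add_X_add_one {K : Type*} [Field K] {m : ℕ} (hm : 2 ≤ m) :
    ¬ IsUnit (X ^ m + X + 1 : Polynomial K) := by
  have hd : (X ^ m + X + 1 : Polynomial K).natDegree = m := by
    rw [add_assoc, natDegree_add_eq_left_of_natDegree_lt, natDegree_X_pow]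
    rw [← C_1, natDegree_X_add_C, natDegree_X_pow]
    lia
  intro h
  have := natDegree_eq_zero_of_isUnit h
  lia

theorem odd_iff_of_two_mul_eq_add_sq {a A : ℤ} (ha : Odd a) (hA : 2 * A = a + a ^ 2) :
    Odd A ↔ a ≡ 1 [ZMOD 4] := by
  obtain ⟨k, rfl⟩ := ha
  obtain rfl : A = 2 * (k ^ 2 + k) + (k + 1) := by linarith
  rw [Int.odd_iff, Int.ModEq]
  lia

theorem stmt_11 (a b c : ℤ) (n : ℕ) (hac : ¬ (2 : ℤ) ∣ a * c) (hb2 : (2 : ℤ) ∣ b)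
    (hb4 : ¬ (4 : ℤ) ∣ b) (hn : 2 < n) (hneven : 2 ∣ n)
    (b' : ℤ) (hb' : b = 2 * b') (A Cc : ℤ) (hA : 2 * A = a + a ^ 2) (hCc : 2 * Cc = c + c ^ 2)
    (F : Polynomial ℤ) (hF : F = C A * X ^ 2 + C (a * c + b') * X + C Cc) :
    IsCoprime (F.map (Int.castRingHom (ZMod 2)))
        ((X ^ (n / 2) + C a * X + C c : Polynomial ℤ).map (Int.castRingHom (ZMod 2))) ↔
      (a ≡ 1 [ZMOD 4] ∨ c ≡ 1 [ZMOD 4]) := by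
  rw [Int.two_dvd_ne_zero, ← Int.odd_iff, Int.odd_mul] at hac
  obtain ⟨ha, hc⟩ := hac
  have hm : 2 ≤ n / 2 := by lia
  have hb : Odd b' := by rw [Int.odd_iff]; lia
  have ha2 : (a : ZMod 2) = 1 := ZMod.intCast_eq_one_iff_odd.2 ha
  have hc2 : (c : ZMod 2) = 1 := ZMod.intCast_eq_one_iff_odd.2 hc
  have hmid : (a : ZMod 2) * c + b' = 0 := by
    rw [ha2, hc2, ZMod.intCast_eq_one_iff_odd.2 hb]; rfl
  have hFmap : F.map (Int.castRingHom (ZMod 2)) =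
      C (A : ZMod 2) * X ^ 2 + C (Cc : ZMod 2) := by
    have hmid' : C ((a : ZMod 2) * c + b') = 0 := by rw [hmid, C_0]
    rw [hF]
    simp only [Polynomial.map_add, Polynomial.map_mul, Polynomial.map_pow, map_X, map_C,
      eq_intCast (Int.castRingHom (ZMod 2)), Int.cast_add, Int.cast_mul, hmid', zero_mul, add_zero]
  have hqmap : (X ^ (n / 2) + C a * X + C c : Polynomial ℤ).map (Int.castRingHom (ZMod 2)) =
      X ^ (n / 2) + X + 1 := by
    simp only [Polynomial.map_add, Polynomial.map_mul, Polynomial.map_pow, map_X, map_C,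
      eq_intCast (Int.castRingHom (ZMod 2)), ha2, hc2, C_1, one_mul]
  rw [hFmap, hqmap, ← odd_iff_of_two_mul_eq_add_sq ha hA, ← odd_iff_of_two_mul_eq_add_sq hc hCc]
  have hX : IsCoprime (X : Polynomial (ZMod 2)) (X ^ (n / 2) + X + 1) := by
    have h0 : n / 2 ≠ 0 := by lia
    simpa using isCoprime_X_sub_C_of_eval_ne_zero (r := (0 : ZMod 2))
      (q := X ^ (n / 2) + X + 1) (by simp [h0])
  have hX1 : IsCoprime (X - C 1 : Polynomial (ZMod 2)) (X ^ (n / 2) + X + 1) :=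
    isCoprime_X_sub_C_of_eval_ne_zero (by
      simp only [eval_add, eval_pow, eval_X, one_pow, eval_one]; decide)
  rcases Int.even_or_odd A with hAe | hAo <;> rcases Int.even_or_odd Cc with hCe | hCo
  · rw [ZMod.intCast_eq_zero_iff_even.2 hAe, ZMod.intCast_eq_zero_iff_even.2 hCe]
    simp [isCoprime_zero_left, not_isUnit_X_pow_add_X_add_one hm, hAe, hCe]
  · rw [ZMod.intCast_eq_zero_iff_even.2 hAe, ZMod.intCast_eq_one_iff_odd.2 hCo]
    simp [isCoprime_one_left, hCo]
  · rw [ZMod.intCast_eq_one_iff_odd.2 hAo, ZMod.intCast_eq_zero_iff_even.2 hCe]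
    simp [hX.pow_left, hAo]
  · rw [ZMod.intCast_eq_one_iff_odd.2 hAo, ZMod.intCast_eq_one_iff_odd.2 hCo]
    have hsq : (C 1 * X ^ 2 + C 1 : Polynomial (ZMod 2)) = (X - C 1) ^ 2 := by
      rw [sub_pow_char]
      simp [CharTwo.sub_eq_add]
    rw [hsq]
    exact iff_of_true hX1.pow_left (Or.inl hAo)
end
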